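/- There exist a properly convex domain Ω ⊆ ℝP³ and a discrete subgroup Γ of SL^±₄(ℝ) preserving Ω and acting properly discontinuously and cocompactly on Ω, such that: Γ is strongly irreducible (so Ω is indecomposable and divisible); Ω is not strictly convex; and every nondegenerate projective line segment contained in the boundary ∂Ω is contained in the boundary ∂Δ of some properly embedded 2-simplex (triangle) Δ in Ω. -/

import Mathlib

open Matrix

noncomputable section

/-- `ℝ^{d+1}`. -/
abbrev Vec (d : ℕ) := Fin (d + 1) → ℝ

/-- The real projective space `ℝP^d`. -/
abbrev RP (d : ℕ) := Projectivization ℝ (Vec d)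

instance (d : ℕ) : TopologicalSpace (RP d) :=
  inferInstanceAs (TopologicalSpace (Quotient (projectivizationSetoid ℝ (Vec d))))

/-- The projective transformation of `ℝP^d` induced by an invertible matrix. -/
def projMap {d : ℕ} (g : GL (Fin (d + 1)) ℝ) : RP d → RP d :=
  Projectivization.map (Matrix.mulVecLin (g : Matrix (Fin (d + 1)) (Fin (d + 1)) ℝ))
    (by
      intro x y hxy
      have hdet : IsUnit (g : Matrix (Fin (d + 1)) (Fin (d + 1)) ℝ).det :=
        (Matrix.isUnit_iff_isUnit_det _).mp g.isUnit
      have h := congrArg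
        (Matrix.mulVec ((g : Matrix (Fin (d + 1)) (Fin (d + 1)) ℝ))⁻¹) hxy
      simpa [Matrix.mulVecLin_apply, Matrix.mulVec_mulVec,
        Matrix.nonsing_inv_mul _ hdet] using h)

/-- A sharp convex open cone in `ℝ^{d+1}`: nonempty, open, convex, stable under positive
scalars, containing no affine line. -/
def IsProperCone {d : ℕ} (C : Set (Vec d)) : Prop :=
  C.Nonempty ∧ IsOpen C ∧ Convex ℝ C ∧
    (∀ x ∈ C, ∀ t : ℝ, 0 < t → t • x ∈ C) ∧
    ¬ ∃ x v : Vec d, v ≠ 0 ∧ ∀ t : ℝ, x + t • v ∈ C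

/-- The projectivization of a cone: a subset of `ℝP^d`. -/
def projOfCone {d : ℕ} (C : Set (Vec d)) : Set (RP d) :=
  {P | ∃ (v : Vec d) (hv : v ≠ 0), v ∈ C ∧ P = Projectivization.mk ℝ v hv}

/-- `Ω` is a properly convex domain if it is the projectivization of a sharp convex open
cone. -/
def IsProperlyConvexDomain {d : ℕ} (Ω : Set (RP d)) : Prop :=
  ∃ C : Set (Vec d), IsProperCone C ∧ Ω = projOfCone C

/-- Membership in `SL^±_{d+1}(ℝ)`: determinant `±1`. -/
def detPM1 {d : ℕ} (g : GL (Fin (d + 1)) ℝ) : Prop :=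
  (g : Matrix (Fin (d + 1)) (Fin (d + 1)) ℝ).det = 1 ∨
  (g : Matrix (Fin (d + 1)) (Fin (d + 1)) ℝ).det = -1

/-- `Γ` preserves `Ω` (projectively). -/
def PreservesDomain {d : ℕ} (Γ : Subgroup (GL (Fin (d + 1)) ℝ)) (Ω : Set (RP d)) : Prop :=
  ∀ γ ∈ Γ, projMap γ '' Ω = Ω

/-- The action of `Γ` on `Ω` is properly discontinuous. -/
def ProperlyDiscontinuousOn {d : ℕ} (Γ : Subgroup (GL (Fin (d + 1)) ℝ))
    (Ω : Set (RP d)) : Prop :=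
  ∀ K : Set (RP d), K ⊆ Ω → IsCompact K →
    {γ : Γ | (projMap (γ : GL (Fin (d + 1)) ℝ) '' K ∩ K).Nonempty}.Finite

/-- The action of `Γ` on `Ω` is cocompact: `Ω/Γ` is compact. -/
def CocompactOn {d : ℕ} (Γ : Subgroup (GL (Fin (d + 1)) ℝ)) (Ω : Set (RP d)) : Prop :=
  ∃ K : Set (RP d), IsCompact K ∧ K ⊆ Ω ∧
    (⋃ γ ∈ Γ, projMap γ '' K) = Ω

/-- `Ω` is divided by `Γ`: `Γ` consists of determinant-`±1` matrices, is discrete,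
preserves `Ω`, and acts properly discontinuously and cocompactly on `Ω`. -/
def Divides {d : ℕ} (Γ : Subgroup (GL (Fin (d + 1)) ℝ)) (Ω : Set (RP d)) : Prop :=
  (∀ γ ∈ Γ, detPM1 γ) ∧ DiscreteTopology Γ ∧ PreservesDomain Γ Ω ∧
    ProperlyDiscontinuousOn Γ Ω ∧ CocompactOn Γ Ω

/-- `Ω` is strictly convex: its boundary contains no nondegenerate projective line
segment. -/
def IsStrictlyConvexDomain {d : ℕ} (Ω : Set (RP d)) : Prop :=
  ∀ v w : Vec d, LinearIndependent ℝ ![v, w] →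
    ¬ ∀ t ∈ Set.Icc (0 : ℝ) 1, ∀ h : t • v + (1 - t) • w ≠ 0,
        Projectivization.mk ℝ (t • v + (1 - t) • w) h ∈ frontier Ω

/-- Every finite-index subgroup of `Γ` acts irreducibly on `ℝ^{d+1}`. -/
def StronglyIrreducible {d : ℕ} (Γ : Subgroup (GL (Fin (d + 1)) ℝ)) : Prop :=
  ∀ Δ : Subgroup (GL (Fin (d + 1)) ℝ), Δ ≤ Γ → (Δ.subgroupOf Γ).FiniteIndex →
    ∀ W : Submodule ℝ (Vec d),
      (∀ γ ∈ Δ, ∀ x ∈ W,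
        Matrix.mulVec ((γ : GL (Fin (d + 1)) ℝ) : Matrix (Fin (d + 1)) (Fin (d + 1)) ℝ) x ∈ W) →
      W = ⊥ ∨ W = ⊤

/-- The `k`-simplex spanned by `v : Fin (k+1) → ℝ^{d+1}` in `ℝP^d`. -/
def simplexSet {d k : ℕ} (v : Fin (k + 1) → Vec d) : Set (RP d) :=
  {P | ∃ t : Fin (k + 1) → ℝ, (∀ i, 0 ≤ t i) ∧ t ≠ 0 ∧
    ∃ h : (∑ i, t i • v i) ≠ 0, P = Projectivization.mk ℝ (∑ i, t i • v i) h}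

/-- The relative interior of the `k`-simplex spanned by `v`. -/
def simplexInterior {d k : ℕ} (v : Fin (k + 1) → Vec d) : Set (RP d) :=
  {P | ∃ t : Fin (k + 1) → ℝ, (∀ i, 0 < t i) ∧
    ∃ h : (∑ i, t i • v i) ≠ 0, P = Projectivization.mk ℝ (∑ i, t i • v i) h}

/-- A properly embedded `k`-simplex in `Ω`: relative interior inside `Ω` and boundary
inside `∂Ω`. -/
def ProperlyEmbeddedSimplex {d k : ℕ} (Ω : Set (RP d)) (v : Fin (k + 1) → Vec d) : Prop :=
  LinearIndependent ℝ v ∧ simplexInterior v ⊆ Ω ∧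
    simplexSet v \ simplexInterior v ⊆ frontier Ω

/-- `φ` cuts out a supporting hyperplane of `Ω` at `x`. -/
def IsSupportingAt {d : ℕ} (Ω : Set (RP d)) (φ : Module.Dual ℝ (Vec d)) (x : RP d) : Prop :=
  φ ≠ 0 ∧ φ x.rep = 0 ∧ ∀ P ∈ Ω, φ (Projectivization.rep P) ≠ 0

end

namespace BenoistPrism

noncomputable section

/-- The linear action of an invertible matrix on `ℝ⁴`. -/
def act (g : GL (Fin 4) ℝ) : Vec 3 →ₗ[ℝ] Vec 3 :=
  Matrix.mulVecLin (g : Matrix (Fin 4) (Fin 4) ℝ)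

lemma act_one (x : Vec 3) : act 1 x = x := by simp [act]

lemma act_mul (g h : GL (Fin 4) ℝ) (x : Vec 3) : act (g * h) x = act g (act h x) := by
  simp [act]

lemma act_inv_act (g : GL (Fin 4) ℝ) (x : Vec 3) : act g⁻¹ (act g x) = x := by
  rw [← act_mul, inv_mul_cancel, act_one]

lemma act_act_inv (g : GL (Fin 4) ℝ) (x : Vec 3) : act g (act g⁻¹ x) = x := by
  rw [← act_mul, mul_inv_cancel, act_one]

lemma gl_ext {g h : GL (Fin 4) ℝ} (H : ∀ x, act g x = act h x) : g = h := by
  apply Units.ext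
  exact Matrix.mulVec_injective (funext H)

/-- The linear forms whose kernels are the walls of the prism. -/
def form : Fin 5 → Vec 3 :=
  ![![1, -1, 0, 0], ![0, 1, -1, 0], ![-1, 0, 2, 0], ![1, 1, 1, -1], ![0, 0, 0, 1]]

/-- The poles of the reflections in the walls of the prism. -/
def pole : Fin 5 → Vec 3 :=
  ![![1, -1, 0, 0], ![0, 1, -1, 0], ![-1, 0, 1 / 2, 0], ![-2, -2, -2, -8], ![0, 0, 0, 2]]

/-- The Cartan matrix of the reflections. -/
def cartan (i j : Fin 5) : ℝ := form i ⬝ᵥ pole j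

lemma cartan_self (i : Fin 5) : cartan i i = 2 := by
  fin_cases i <;> simp [cartan, form, pole, Matrix.vecHead, Matrix.vecTail] <;> norm_num

/-- The matrix of the `i`-th reflection. -/
def reflMat (i : Fin 5) : Matrix (Fin 4) (Fin 4) ℝ :=
  1 - Matrix.vecMulVec (pole i) (form i)

lemma reflMat_mulVec (i : Fin 5) (x : Vec 3) :
    reflMat i *ᵥ x = x - (form i ⬝ᵥ x) • pole i := by
  rw [reflMat, Matrix.sub_mulVec, Matrix.one_mulVec, Matrix.vecMulVec_mulVec]
  simp

lemma reflMat_mul_self (i : Fin 5) : reflMat i * reflMat i = 1 := by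
  apply Matrix.mulVec_injective
  funext x
  have h : form i ⬝ᵥ pole i = 2 := cartan_self i
  rw [← Matrix.mulVec_mulVec, reflMat_mulVec, reflMat_mulVec, Matrix.one_mulVec,
    dotProduct_sub, dotProduct_smul, h]
  simp only [smul_eq_mul]
  module

/-- The `i`-th reflection, as an invertible matrix. -/
def refl (i : Fin 5) : GL (Fin 4) ℝ :=
  ⟨reflMat i, reflMat i, reflMat_mul_self i, reflMat_mul_self i⟩

lemma act_refl (i : Fin 5) (x : Vec 3) : act (refl i) x = x - (form i ⬝ᵥ x) • pole i :=
  reflMat_mulVec i x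

lemma refl_mul_self (i : Fin 5) : refl i * refl i = 1 := Units.ext (reflMat_mul_self i)

lemma refl_mul_refl_mul (i : Fin 5) (g : GL (Fin 4) ℝ) : refl i * (refl i * g) = g := by
  rw [← mul_assoc, refl_mul_self, one_mul]

lemma refl_inv (i : Fin 5) : (refl i)⁻¹ = refl i := inv_eq_of_mul_eq_one_left (refl_mul_self i)

lemma form_act_refl (i j : Fin 5) (x : Vec 3) :
    form i ⬝ᵥ act (refl j) x = form i ⬝ᵥ x - (form j ⬝ᵥ x) * cartan i j := by
  rw [act_refl, dotProduct_sub, dotProduct_smul, smul_eq_mul, cartan]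

/-- The reflection group of the prism. -/
def Gam : Subgroup (GL (Fin 4) ℝ) := Subgroup.closure (Set.range refl)

lemma refl_mem (i : Fin 5) : refl i ∈ Gam := Subgroup.subset_closure ⟨i, rfl⟩

/-- The closed cone over the prism. -/
def prism : Set (Vec 3) := {x | ∀ i, 0 ≤ form i ⬝ᵥ x}

/-! ### Word length -/

lemma word_mem (L : List (Fin 5)) : (L.map refl).prod ∈ Gam := by
  apply Subgroup.list_prod_mem
  intro x hx
  obtain ⟨i, -, rfl⟩ := List.mem_map.1 hx
  exact refl_mem i

lemma exists_word {g : GL (Fin 4) ℝ} (hg : g ∈ Gam) :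
    ∃ L : List (Fin 5), (L.map refl).prod = g := by
  induction hg using Subgroup.closure_induction with
  | mem x hx => obtain ⟨i, rfl⟩ := hx; exact ⟨[i], by simp⟩
  | one => exact ⟨[], rfl⟩
  | mul x y _ _ hx hy =>
    obtain ⟨L, rfl⟩ := hx
    obtain ⟨M, rfl⟩ := hy
    exact ⟨L ++ M, by simp⟩
  | inv x _ hx =>
    obtain ⟨L, rfl⟩ := hx
    refine ⟨L.reverse, ?_⟩
    rw [List.prod_inv_reverse, List.map_map, List.map_reverse]
    congr 2

/-- The word length with respect to the five reflections. -/
def len (g : GL (Fin 4) ℝ) : ℕ :=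
  sInf {n | ∃ L : List (Fin 5), L.length = n ∧ (L.map refl).prod = g}

lemma len_word_le (L : List (Fin 5)) : len (L.map refl).prod ≤ L.length :=
  Nat.sInf_le ⟨L, rfl, rfl⟩

lemma exists_reduced_word {g : GL (Fin 4) ℝ} (hg : g ∈ Gam) :
    ∃ L : List (Fin 5), L.length = len g ∧ (L.map refl).prod = g := by
  obtain ⟨L, hL⟩ := exists_word hg
  exact Nat.sInf_mem (s := {n | ∃ L : List (Fin 5), L.length = n ∧ (L.map refl).prod = g})
    ⟨_, L, rfl, hL⟩

lemma len_refl_mul_le (i : Fin 5) {g : GL (Fin 4) ℝ} (hg : g ∈ Gam) :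
    len (refl i * g) ≤ len g + 1 := by
  obtain ⟨L, hL, rfl⟩ := exists_reduced_word hg
  rw [← hL]
  exact len_word_le (i :: L)

lemma exists_descent {g : GL (Fin 4) ℝ} (hg : g ∈ Gam) (h1 : g ≠ 1) :
    ∃ i, ∃ h ∈ Gam, g = refl i * h ∧ len g = len h + 1 := by
  obtain ⟨L, hL, rfl⟩ := exists_reduced_word hg
  cases L with
  | nil => exact absurd rfl h1
  | cons i L =>
    refine ⟨i, (L.map refl).prod, word_mem L, by simp, ?_⟩
    have h2 := len_word_le L
    have h3 := len_refl_mul_le i (word_mem L)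
    simp only [List.map_cons, List.prod_cons, List.length_cons] at hL ⊢
    omega

/-- The alternating word of length `n` in the reflections `i`, `j`, beginning with `i`. -/
def alt (i j : Fin 5) : ℕ → GL (Fin 4) ℝ
  | 0 => 1
  | n + 1 => refl i * alt j i n

lemma alt_succ_right (i j : Fin 5) (n : ℕ) :
    alt i j (n + 1) = alt i j n * refl (if Even n then i else j) := by
  induction n generalizing i j with
  | zero => simp [alt]
  | succ n ih =>
    rw [alt, ih j i, alt, mul_assoc]
    congr 3
    simp only [Nat.even_add_one]
    split_ifs <;> rfl

lemma alt_mem (i j : Fin 5) (n : ℕ) : alt i j n ∈ Gam := by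
  induction n generalizing i j with
  | zero => exact one_mem _
  | succ n ih => exact mul_mem (refl_mem i) (ih j i)

lemma len_alt_mul_le (i j : Fin 5) (n : ℕ) {v : GL (Fin 4) ℝ} (hv : v ∈ Gam) :
    len (alt i j n * v) ≤ n + len v := by
  induction n generalizing i j with
  | zero => simp [alt]
  | succ n ih =>
    rw [alt, mul_assoc]
    have h1 := len_refl_mul_le i (mul_mem (alt_mem j i n) hv)
    have h2 := ih j i
    omega

/-- Minimal double coset style decomposition of `g` along the dihedral subgroup of `i`, `j`. -/
lemma exists_dihedral_decomposition (i j : Fin 5) {g h : GL (Fin 4) ℝ} (hh : h ∈ Gam)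
    (hgh : g = refl j * h) (hl : len g = len h + 1) :
    ∃ n, ∃ v ∈ Gam, g = alt j i (n + 1) * v ∧ len g = n + 1 + len v ∧
      len v ≤ len (refl i * v) ∧ len v ≤ len (refl j * v) := by
  classical
  have hex : ∃ m, ∃ n, ∃ v ∈ Gam, g = alt j i (n + 1) * v ∧ len g = n + 1 + len v ∧
      len v = m := ⟨len h, 0, h, hh, by simp [alt, hgh], by omega, rfl⟩
  obtain ⟨n, v, hv, hg, hlen, hm⟩ := Nat.find_spec hex
  have hmin : ∀ n', ∀ v' ∈ Gam, g = alt j i (n' + 1) * v' → len g = n' + 1 + len v' →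
      len v ≤ len v' := by
    intro n' v' hv' h1 h2
    rw [hm]
    exact Nat.find_min' hex ⟨n', v', hv', h1, h2, rfl⟩
  have next : len v ≤ len (refl (if Even (n + 1) then j else i) * v) := by
    by_contra hlt
    set k := if Even (n + 1) then j else i with hk
    have hv' : refl k * v ∈ Gam := mul_mem (refl_mem k) hv
    have h1 := len_refl_mul_le k hv'
    rw [refl_mul_refl_mul] at h1
    have := hmin (n + 1) _ hv' (by rw [alt_succ_right, mul_assoc, ← hk, refl_mul_refl_mul, hg])
      (by omega)
    omega
  have last : len v ≤ len (refl (if Even n then j else i) * v) := by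
    by_contra hlt
    set k := if Even n then j else i with hk
    have hv' : refl k * v ∈ Gam := mul_mem (refl_mem k) hv
    have h1 := len_alt_mul_le j i n hv'
    have h2 : alt j i n * (refl k * v) = g := by rw [← mul_assoc, hk, ← alt_succ_right, ← hg]
    rw [h2] at h1
    omega
  refine ⟨n, v, hv, hg, hlen, ?_⟩
  by_cases hn : Even n
  · simp only [Nat.even_add_one, hn, not_true_eq_false, if_true, if_false] at next last
    exact ⟨next, last⟩
  · simp only [Nat.even_add_one, hn, not_false_eq_true, if_true, if_false] at next last
    exact ⟨last, next⟩

lemma refl_comm {i j : Fin 5} (h1 : cartan i j = 0) (h2 : cartan j i = 0) :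
    refl i * refl j = refl j * refl i := by
  apply gl_ext
  intro x
  rw [act_mul, act_mul, act_refl i, act_refl j (act _ _), form_act_refl, form_act_refl, h1, h2,
    act_refl, act_refl]
  module

lemma refl_braid {i j : Fin 5} (h : cartan i j * cartan j i = 1) :
    refl i * (refl j * refl i) = refl j * (refl i * refl j) := by
  apply gl_ext
  intro x
  have e1 := cartan_self i
  have e2 := cartan_self j
  simp only [act_mul]
  rw [act_refl i (act _ _), act_refl j (act (refl i) (act _ _))]
  simp only [form_act_refl]
  rw [act_refl i (act _ _), act_refl j (act _ _)]
  simp only [form_act_refl]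
  rw [act_refl i, act_refl j, e1, e2]
  match_scalars
  · ring
  · linear_combination (-(form i ⬝ᵥ x)) * h
  · linear_combination (form j ⬝ᵥ x) * h

/-! ### The fundamental chamber property -/

lemma cartan_eq (i j : Fin 5) : cartan i j =
    !![2, -1, -1, 0, 0; -1, 2, -1 / 2, 0, 0; -1, -2, 2, -2, 0; 0, 0, -1 / 2, 2, -2;
      0, 0, 0, -8, 2] i j := by
  fin_cases i <;> fin_cases j <;>
    simp [cartan, form, pole, Matrix.vecHead, Matrix.vecTail] <;> norm_num

lemma cartan_cases {i j : Fin 5} (h : i ≠ j) :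
    (cartan i j = 0 ∧ cartan j i = 0) ∨
    (cartan i j < 0 ∧ cartan j i < 0 ∧ cartan i j * cartan j i = 1) ∨
    (cartan i j < 0 ∧ cartan j i < 0 ∧ cartan i j * cartan j i = 16) := by
  simp only [cartan_eq]
  fin_cases i <;> fin_cases j <;> first
    | exact absurd rfl h
    | (left; constructor <;> norm_num [Matrix.vecHead, Matrix.vecTail]; done)
    | (right; left; refine ⟨?_, ?_, ?_⟩ <;> norm_num [Matrix.vecHead, Matrix.vecTail]; done)
    | (right; right; refine ⟨?_, ?_, ?_⟩ <;> norm_num [Matrix.vecHead, Matrix.vecTail])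

lemma form_alt_nonneg {i j : Fin 5} (hij : cartan i j < 0) (hji : cartan j i < 0)
    (h : cartan i j * cartan j i = 16) (m : ℕ) {y : Vec 3} (hi : 0 ≤ form i ⬝ᵥ y)
    (hj : 0 ≤ form j ⬝ᵥ y) :
    0 ≤ form i ⬝ᵥ act (alt j i m) y ∧
      0 ≤ 2 * (form i ⬝ᵥ act (alt j i m) y) - cartan i j * (form j ⬝ᵥ act (alt j i m) y) := by
  induction m generalizing i j with
  | zero =>
    rw [alt, act_one]
    exact ⟨hi, by nlinarith⟩
  | succ m ih =>
    obtain ⟨h1, h2⟩ := ih hji hij (by rw [mul_comm, h]) hj hi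
    rw [alt, act_mul, form_act_refl, form_act_refl, cartan_self]
    set a := form i ⬝ᵥ act (alt i j m) y
    set b := form j ⬝ᵥ act (alt i j m) y
    have h3 : 0 ≤ -cartan j i * a + 2 * b := by linarith
    have h4 : 0 ≤ -cartan i j * (-cartan j i * a + 2 * b) := mul_nonneg (by linarith) h3
    have key : 16 * a ≥ 2 * cartan i j * b := by
      have : -cartan i j * (-cartan j i * a + 2 * b) =
        (cartan i j * cartan j i) * a - 2 * cartan i j * b := by ring
      rw [this, h] at h4
      linarith
    have h5 : cartan i j * b ≤ 0 := mul_nonpos_of_nonpos_of_nonneg hij.le h1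
    constructor <;> nlinarith

lemma form_act_nonneg_of_len_le {g : GL (Fin 4) ℝ} (hg : g ∈ Gam) {i : Fin 5}
    (hi : len g ≤ len (refl i * g)) {x : Vec 3} (hx : x ∈ prism) :
    0 ≤ form i ⬝ᵥ act g x := by
  induction hn : len g using Nat.strong_induction_on generalizing g i with
  | _ N ih =>
  by_cases h1 : g = 1
  · rw [h1, act_one]
    exact hx i
  obtain ⟨j, h, hh, hgh, hl⟩ := exists_descent hg h1
  have hij : i ≠ j := by
    rintro rfl
    rw [hgh, refl_mul_refl_mul, ← hgh] at hi
    omega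
  obtain ⟨n, v, hv, hgv, hlv, hvi, hvj⟩ := exists_dihedral_decomposition i j hh hgh hl
  have hyi := ih (len v) (by omega) hv hvi rfl
  have hyj := ih (len v) (by omega) hv hvj rfl
  have hm : ∀ k l m, len (alt k l m * v) ≤ m + len v := fun k l m => len_alt_mul_le k l m hv
  rcases cartan_cases hij with ⟨c1, c2⟩ | ⟨c1, c2, c3⟩ | ⟨c1, c2, c3⟩
  · rcases n with _ | n
    · rw [hgv, act_mul, alt, alt, mul_one, form_act_refl, c1]
      simpa using hyi
    · exfalso
      have : refl i * g = refl j * (alt j i n * v) := by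
        rw [hgv, alt, alt, ← mul_assoc, ← mul_assoc, refl_comm c1 c2]
        simp only [mul_assoc, refl_mul_refl_mul]
      have h2 := len_refl_mul_le j (mul_mem (alt_mem j i n) hv)
      have h3 := hm j i n
      rw [← this] at h2
      omega
  · rcases n with _ | _ | n
    · rw [hgv, act_mul, alt, alt, mul_one, form_act_refl]
      have := mul_nonneg hyj (neg_nonneg.2 c1.le)
      linarith
    · rw [hgv, act_mul, alt, alt, alt, mul_one, act_mul, form_act_refl, form_act_refl,
        form_act_refl, cartan_self]
      have h4 : form i ⬝ᵥ act v x - form i ⬝ᵥ act v x * 2 -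
          (form j ⬝ᵥ act v x - form i ⬝ᵥ act v x * cartan j i) * cartan i j =
          (cartan i j * cartan j i - 1) * (form i ⬝ᵥ act v x) +
          form j ⬝ᵥ act v x * (- cartan i j) := by ring
      rw [c3] at h4
      have := mul_nonneg hyj (neg_nonneg.2 c1.le)
      linarith
    · exfalso
      have : refl i * g = refl j * (refl i * (alt i j n * v)) := by
        rw [hgv, alt, alt, alt]
        calc _ = (refl i * (refl j * refl i)) * (refl j * alt i j n) * v := by
                simp only [mul_assoc]
          _ = _ := by
                rw [refl_braid c3]
                simp only [mul_assoc, refl_mul_refl_mul]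
      have h2 := len_refl_mul_le j (mul_mem (refl_mem i) (mul_mem (alt_mem i j n) hv))
      have h3 := len_refl_mul_le i (mul_mem (alt_mem i j n) hv)
      have h4 := hm i j n
      rw [← this] at h2
      omega
  · rw [hgv, act_mul]
    exact (form_alt_nonneg c1 c2 c3 (n + 1) hyi hyj).1

lemma len_refl_mul_lt {g : GL (Fin 4) ℝ} (hg : g ∈ Gam) {i : Fin 5} {x : Vec 3}
    (hx : x ∈ prism) (h : form i ⬝ᵥ act g x < 0) : len (refl i * g) < len g := by
  by_contra hlt
  exact absurd (form_act_nonneg_of_len_le hg (not_lt.1 hlt) hx) (not_le.2 h)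

/-! ### The Tits cone -/

/-- The union of the translates of the prism. -/
def tits : Set (Vec 3) := {x | ∃ g ∈ Gam, ∃ p ∈ prism, act g p = x}

lemma prism_subset_tits : prism ⊆ tits := fun x hx => ⟨1, one_mem _, x, hx, act_one x⟩

lemma act_mem_tits {g : GL (Fin 4) ℝ} (hg : g ∈ Gam) {x : Vec 3} (hx : x ∈ tits) :
    act g x ∈ tits := by
  obtain ⟨h, hh, p, hp, rfl⟩ := hx
  exact ⟨g * h, mul_mem hg hh, p, hp, act_mul g h p⟩

lemma mem_tits_of_act {g : GL (Fin 4) ℝ} (hg : g ∈ Gam) {x : Vec 3} (hx : act g x ∈ tits) :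
    x ∈ tits := by
  rw [← act_inv_act g x]
  exact act_mem_tits (inv_mem hg) hx

lemma smul_mem_prism {x : Vec 3} (hx : x ∈ prism) {t : ℝ} (ht : 0 ≤ t) : t • x ∈ prism := by
  intro i
  rw [dotProduct_smul]
  exact mul_nonneg ht (hx i)

lemma smul_mem_tits {x : Vec 3} (hx : x ∈ tits) {t : ℝ} (ht : 0 ≤ t) : t • x ∈ tits := by
  obtain ⟨h, hh, p, hp, rfl⟩ := hx
  exact ⟨h, hh, t • p, smul_mem_prism hp ht, map_smul _ _ _⟩

lemma add_act_mem_tits {w : GL (Fin 4) ℝ} (hw : w ∈ Gam) {p q : Vec 3} (hp : p ∈ prism)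
    (hq : q ∈ prism) : p + act w q ∈ tits := by
  induction hn : len w using Nat.strong_induction_on generalizing w p q with
  | _ N ih =>
  by_cases hmem : p + act w q ∈ prism
  · exact prism_subset_tits hmem
  set y := act w q with hy
  have hneg : ∃ k, form k ⬝ᵥ p + form k ⬝ᵥ y < 0 := by
    by_contra hcon
    push Not at hcon
    exact hmem fun k => by rw [dotProduct_add]; exact hcon k
  classical
  obtain ⟨k, hk⟩ := hneg
  have hS : (Finset.univ.filter fun i => form i ⬝ᵥ y < 0).Nonempty :=
    ⟨k, by simpa using (by linarith [hp k] : form k ⬝ᵥ y < 0)⟩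
  obtain ⟨i, hiS, himin⟩ :=
    Finset.exists_min_image _ (fun i => form i ⬝ᵥ p / -(form i ⬝ᵥ y)) hS
  have hi : form i ⬝ᵥ y < 0 := by simpa using hiS
  set t := form i ⬝ᵥ p / -(form i ⬝ᵥ y) with ht
  have ht0 : 0 ≤ t := div_nonneg (hp i) (by linarith)
  have hkneg : form k ⬝ᵥ y < 0 := by linarith [hp k]
  have ht1 : t ≤ 1 := (himin k (by simpa using hkneg)).trans
    ((div_le_one (by linarith)).2 (by linarith))
  have hti : form i ⬝ᵥ p + t * (form i ⬝ᵥ y) = 0 := by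
    rw [ht]
    field_simp [hi.ne]
    ring
  have hp' : p + t • y ∈ prism := by
    intro l
    rw [dotProduct_add, dotProduct_smul, smul_eq_mul]
    rcases le_or_gt 0 (form l ⬝ᵥ y) with hl | hl
    · exact add_nonneg (hp l) (mul_nonneg ht0 hl)
    · have := himin l (by simpa using hl)
      rw [le_div_iff₀ (by linarith)] at this
      linarith
  apply mem_tits_of_act (refl_mem i)
  have e : act (refl i) (p + y) = (p + t • y) + act (refl i * w) ((1 - t) • q) := by
    have e1 : p + y = (p + t • y) + (1 - t) • y := by module
    have e2 : act (refl i) (p + t • y) = p + t • y := by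
      rw [act_refl, dotProduct_add, dotProduct_smul, smul_eq_mul, hti, zero_smul, sub_zero]
    rw [e1, map_add, e2, map_smul, map_smul, act_mul]
  rw [e]
  exact ih _ (by rw [← hn]; exact len_refl_mul_lt hw hq hi) (mul_mem (refl_mem i) hw) hp'
    (smul_mem_prism hq (by linarith)) rfl

lemma add_mem_tits {x y : Vec 3} (hx : x ∈ tits) (hy : y ∈ tits) : x + y ∈ tits := by
  obtain ⟨g, hg, p, hp, rfl⟩ := hx
  obtain ⟨h, hh, q, hq, rfl⟩ := hy
  apply mem_tits_of_act (inv_mem hg)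
  rw [map_add, act_inv_act, ← act_mul]
  exact add_act_mem_tits (mul_mem (inv_mem hg) hh) hp hq

/-- A linear form that is nonnegative on the prism and nonpositive at the poles is
nonnegative on the Tits cone. -/
lemma dotProduct_nonneg_of_mem_tits {c : Vec 3} (hc : ∀ i, c ⬝ᵥ pole i ≤ 0)
    (hp : ∀ p ∈ prism, 0 ≤ c ⬝ᵥ p) {x : Vec 3} (hx : x ∈ tits) : 0 ≤ c ⬝ᵥ x := by
  obtain ⟨g, hg, p, hpp, rfl⟩ := hx
  induction hn : len g using Nat.strong_induction_on generalizing g with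
  | _ N ih =>
  by_cases h1 : g = 1
  · rw [h1, act_one]
    exact hp p hpp
  obtain ⟨i, h, hh, hgh, hl⟩ := exists_descent hg h1
  have h2 := ih (len h) (by omega) h hh rfl
  have h3 : 0 ≤ form i ⬝ᵥ act h p := form_act_nonneg_of_len_le hh (by rw [← hgh]; omega) hpp
  rw [hgh, act_mul, act_refl, dotProduct_sub, dotProduct_smul, smul_eq_mul]
  have := mul_nonneg h3 (neg_nonneg.2 (hc i))
  linarith

/-! ### The reflections in coordinates -/

lemma act_refl_zero (a b c d : ℝ) : act (refl 0) ![a, b, c, d] = ![b, a, c, d] := by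
  rw [act_refl]
  ext i
  fin_cases i <;> simp [form, pole, Matrix.vecHead, Matrix.vecTail]

lemma act_refl_one (a b c d : ℝ) : act (refl 1) ![a, b, c, d] = ![a, c, b, d] := by
  rw [act_refl]
  ext i
  fin_cases i <;> simp [form, pole, Matrix.vecHead, Matrix.vecTail]

lemma act_refl_two (a b c d : ℝ) : act (refl 2) ![a, b, c, d] = ![2 * c, b, a / 2, d] := by
  rw [act_refl]
  ext i
  fin_cases i <;> (simp [form, pole, Matrix.vecHead, Matrix.vecTail]; try ring)

lemma act_refl_three (a b c d : ℝ) : act (refl 3) ![a, b, c, d] =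
    ![a + 2 * (a + b + c - d), b + 2 * (a + b + c - d), c + 2 * (a + b + c - d),
      d + 8 * (a + b + c - d)] := by
  rw [act_refl]
  ext i
  fin_cases i <;> (simp [form, pole, Matrix.vecHead, Matrix.vecTail]; try ring)

lemma act_refl_four (a b c d : ℝ) : act (refl 4) ![a, b, c, d] = ![a, b, c, -d] := by
  rw [act_refl]
  ext i
  fin_cases i <;> (simp [form, pole, Matrix.vecHead, Matrix.vecTail]; try ring)

lemma vec_eta (x : Vec 3) : x = ![x 0, x 1, x 2, x 3] := by
  ext i
  fin_cases i <;> rfl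

lemma dot_eq (c x : Vec 3) : c ⬝ᵥ x = c 0 * x 0 + c 1 * x 1 + c 2 * x 2 + c 3 * x 3 := by
  simp [dotProduct, Fin.sum_univ_four]

lemma mem_prism_iff (x : Vec 3) : x ∈ prism ↔
    x 1 ≤ x 0 ∧ x 2 ≤ x 1 ∧ x 0 ≤ 2 * x 2 ∧ x 3 ≤ x 0 + x 1 + x 2 ∧ 0 ≤ x 3 := by
  constructor
  · intro h
    have h0 := h 0
    have h1 := h 1
    have h2 := h 2
    have h3 := h 3
    have h4 := h 4
    simp [form, Matrix.vecHead, Matrix.vecTail] at h0 h1 h2 h3 h4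
    refine ⟨?_, ?_, ?_, ?_, ?_⟩ <;> linarith
  · rintro ⟨h0, h1, h2, h3, h4⟩ i
    fin_cases i <;> simp [form, Matrix.vecHead, Matrix.vecTail] <;> linarith

/-! ### A positive linear form -/

/-- A linear form that is positive on the open Tits cone. -/
def hgt : Vec 3 := ![8, 9, 10, -1]

lemma abs_apply_le_of_mem_tits {x : Vec 3} (hx : x ∈ tits) (k : Fin 4) :
    |x k| ≤ 10 * (hgt ⬝ᵥ x) := by
  have key : ∀ s : ℝ, s = 1 ∨ s = -1 → 0 ≤ (hgt + (s / 10) • Pi.single k 1) ⬝ᵥ x := by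
    intro s hs
    refine dotProduct_nonneg_of_mem_tits ?_ ?_ hx
    · intro i
      rw [dot_eq]
      rcases hs with rfl | rfl <;> fin_cases k <;> fin_cases i <;>
        simp [hgt, pole] <;> norm_num
    · intro p hp
      rw [mem_prism_iff] at hp
      rw [dot_eq]
      rcases hs with rfl | rfl <;> fin_cases k <;>
        simp [hgt] <;> linarith
  have h1 := key 1 (Or.inl rfl)
  have h2 := key (-1) (Or.inr rfl)
  rw [add_dotProduct, smul_dotProduct, single_one_dotProduct, smul_eq_mul] at h1 h2
  rw [abs_le]
  constructor <;> linarith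

/-! ### The open cone -/

/-- The interior of the Tits cone. -/
def cone : Set (Vec 3) := interior tits

lemma isOpen_cone : IsOpen cone := isOpen_interior

lemma cone_subset_tits : cone ⊆ tits := interior_subset

lemma add_mem_cone_of_mem_tits {x y : Vec 3} (hx : x ∈ cone) (hy : y ∈ tits) : x + y ∈ cone := by
  have h : (fun z => z + y) '' cone ⊆ tits := by
    rintro _ ⟨z, hz, rfl⟩
    exact add_mem_tits (cone_subset_tits hz) hy
  exact interior_maximal h ((Homeomorph.addRight y).isOpenMap _ isOpen_cone) ⟨x, hx, rfl⟩

lemma add_mem_cone {x y : Vec 3} (hx : x ∈ cone) (hy : y ∈ cone) : x + y ∈ cone :=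
  add_mem_cone_of_mem_tits hx (cone_subset_tits hy)

lemma smul_mem_cone {x : Vec 3} (hx : x ∈ cone) {t : ℝ} (ht : 0 < t) : t • x ∈ cone := by
  have h : (fun z => t • z) '' cone ⊆ tits := by
    rintro _ ⟨z, hz, rfl⟩
    exact smul_mem_tits (cone_subset_tits hz) ht.le
  exact interior_maximal h ((Homeomorph.smulOfNeZero t ht.ne').isOpenMap _ isOpen_cone)
    ⟨x, hx, rfl⟩

lemma smul_mem_cone_iff {x : Vec 3} {t : ℝ} (ht : 0 < t) : t • x ∈ cone ↔ x ∈ cone := by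
  refine ⟨fun h => ?_, fun h => smul_mem_cone h ht⟩
  have := smul_mem_cone h (inv_pos.2 ht)
  rwa [smul_smul, inv_mul_cancel₀ ht.ne', one_smul] at this

lemma continuous_act (g : GL (Fin 4) ℝ) : Continuous (act g) :=
  (act g).continuous_of_finiteDimensional

lemma act_mem_cone {g : GL (Fin 4) ℝ} (hg : g ∈ Gam) {x : Vec 3} (hx : x ∈ cone) :
    act g x ∈ cone := by
  have h : act g⁻¹ ⁻¹' cone ⊆ tits := fun z hz =>
    mem_tits_of_act (inv_mem hg) (cone_subset_tits hz)
  refine interior_maximal h (isOpen_cone.preimage (continuous_act _)) ?_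
  simpa [act_inv_act] using hx

lemma act_mem_cone_iff {g : GL (Fin 4) ℝ} (hg : g ∈ Gam) {x : Vec 3} :
    act g x ∈ cone ↔ x ∈ cone := by
  refine ⟨fun h => ?_, act_mem_cone hg⟩
  rw [← act_inv_act g x]
  exact act_mem_cone (inv_mem hg) h

lemma zero_notMem_cone : (0 : Vec 3) ∉ cone := by
  intro h
  have hc : Filter.Tendsto (fun t : ℝ => t • (-hgt)) (nhdsWithin 0 (Set.Ioi 0))
      (nhds ((0 : ℝ) • (-hgt))) :=
    ((continuous_id.smul continuous_const).tendsto 0).mono_left nhdsWithin_le_nhds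
  rw [zero_smul] at hc
  obtain ⟨t, ht, ht0⟩ := ((hc.eventually (isOpen_cone.mem_nhds h)).and
    self_mem_nhdsWithin).exists
  have h1 := (abs_nonneg _).trans (abs_apply_le_of_mem_tits (cone_subset_tits ht) 0)
  have h2 : (0 : ℝ) < t := ht0
  rw [dot_eq] at h1
  simp [hgt] at h1
  linarith

lemma hgt_pos {x : Vec 3} (hx : x ∈ cone) : 0 < hgt ⬝ᵥ x := by
  by_contra h
  apply zero_notMem_cone
  have : x = 0 := by
    ext k
    have := abs_apply_le_of_mem_tits (cone_subset_tits hx) k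
    exact abs_nonpos_iff.1 (by linarith)
  rwa [← this]

lemma mem_cone_of_form_pos {x : Vec 3} (h : ∀ i, 0 < form i ⬝ᵥ x) : x ∈ cone := by
  have ho : IsOpen {x : Vec 3 | ∀ i, 0 < form i ⬝ᵥ x} := by
    rw [Set.ofPred_forall]
    exact isOpen_iInter_of_finite fun i =>
      isOpen_lt continuous_const (continuous_const.dotProduct continuous_id)
  exact interior_maximal (fun y hy => prism_subset_tits fun i => (hy i).le) ho h

/-- A point in the interior of the prism. -/
def basePt : Vec 3 := ![6, 5, 4, 1]

lemma form_basePt_pos (i : Fin 5) : 0 < form i ⬝ᵥ basePt := by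
  fin_cases i <;> simp [form, basePt, Matrix.vecHead, Matrix.vecTail] <;> norm_num

lemma basePt_mem_cone : basePt ∈ cone := mem_cone_of_form_pos form_basePt_pos

/-- Symmetrization along a dihedral group of order six. -/
lemma symm_three_mem {x : Vec 3} (hx : x ∈ cone) (i j : Fin 5) :
    (x + act (refl i) x) + act (refl j) (x + act (refl i) x) +
      act (refl i) (act (refl j) (x + act (refl i) x)) ∈ cone := by
  have h1 := add_mem_cone hx (act_mem_cone (refl_mem i) hx)
  have h2 := act_mem_cone (refl_mem j) h1
  exact add_mem_cone (add_mem_cone h1 h2) (act_mem_cone (refl_mem i) h2)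

lemma symm_four_mem {x : Vec 3} (hx : x ∈ cone) (i j k : Fin 5) :
    x + act (refl k) x + act (refl j) (act (refl k) x) +
      act (refl i) (act (refl j) (act (refl k) x)) ∈ cone := by
  have h1 := act_mem_cone (refl_mem k) hx
  have h2 := act_mem_cone (refl_mem j) h1
  exact add_mem_cone (add_mem_cone (add_mem_cone hx h1) h2) (act_mem_cone (refl_mem i) h2)

lemma vertex_mem_cone {v w : Vec 3} (hw : w ∈ cone) {t : ℝ} (ht : 0 < t) (h : w = t • v) :
    v ∈ cone := by
  rwa [← smul_mem_cone_iff ht, ← h]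

lemma prism_vertices_mem_cone :
    ![1, 1, 1, 0] ∈ cone ∧ ![2, 1, 1, 0] ∈ cone ∧ ![2, 2, 1, 0] ∈ cone ∧
    ![1, 1, 1, 3] ∈ cone ∧ ![2, 1, 1, 4] ∈ cone ∧ ![2, 2, 1, 5] ∈ cone := by
  have h := basePt_mem_cone
  have s1 := symm_three_mem h 0 1
  have s2 := symm_three_mem h 1 2
  have s3 := symm_three_mem h 0 2
  have t1 := add_mem_cone s1 (act_mem_cone (refl_mem 4) s1)
  have t2 := add_mem_cone s2 (act_mem_cone (refl_mem 4) s2)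
  have t3 := add_mem_cone s3 (act_mem_cone (refl_mem 4) s3)
  have r1 := add_mem_cone s1 (act_mem_cone (refl_mem 3) s1)
  have r2 := symm_four_mem s2 1 2 3
  have r3 := symm_four_mem s3 0 2 3
  simp only [basePt, act_refl_zero, act_refl_one, act_refl_two, act_refl_three, act_refl_four,
    Matrix.cons_add_cons, Matrix.empty_add_empty] at t1 t2 t3 r1 r2 r3
  refine ⟨vertex_mem_cone t1 (t := 60) (by norm_num) ?_,
    vertex_mem_cone t2 (t := 48) (by norm_num) ?_,
    vertex_mem_cone t3 (t := 38) (by norm_num) ?_,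
    vertex_mem_cone r1 (t := 228) (by norm_num) ?_,
    vertex_mem_cone r2 (t := 546) (by norm_num) ?_,
    vertex_mem_cone r3 (t := 432) (by norm_num) ?_⟩ <;> norm_num

lemma mem_cone_of_mem_prism {x : Vec 3} (hx : x ∈ prism) (h0 : x ≠ 0) : x ∈ cone := by
  have hadd : ∀ {u v : Vec 3}, u = 0 ∨ u ∈ cone → v = 0 ∨ v ∈ cone →
      u + v = 0 ∨ u + v ∈ cone := by
    rintro u v (rfl | hu) (rfl | hv)
    · simp
    · simp [hv]
    · simp [hu]
    · exact Or.inr (add_mem_cone hu hv)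
  have hsmul : ∀ {u : Vec 3} {t : ℝ}, 0 ≤ t → u ∈ cone → t • u = 0 ∨ t • u ∈ cone := by
    intro u t ht hu
    rcases ht.eq_or_lt with rfl | ht
    · simp
    · exact Or.inr (smul_mem_cone hu ht)
  obtain ⟨v1, v2, v3, v4, v5, v6⟩ := prism_vertices_mem_cone
  rw [mem_prism_iff] at hx
  obtain ⟨h1, h2, h3, h4, h5⟩ := hx
  set s := x 0 + x 1 + x 2 with hs
  have hs0 : 0 < s := by
    by_contra hcon
    apply h0
    have e0 : x 0 = 0 := by linarith
    have e1 : x 1 = 0 := by linarith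
    have e2 : x 2 = 0 := by linarith
    have e3 : x 3 = 0 := by linarith
    rw [vec_eta x, e0, e1, e2, e3]
    simp
  have hth : x 3 / s ≤ 1 := (div_le_one hs0).2 h4
  have hth0 : 0 ≤ x 3 / s := div_nonneg h5 hs0.le
  have key : ∀ a b c th : ℝ, 0 ≤ a → 0 ≤ b → 0 ≤ c → 0 ≤ th → th ≤ 1 →
      ∀ y : Vec 3, y = ((1 - th) * a) • ![1, 1, 1, 0] + ((1 - th) * b) • ![2, 1, 1, 0] +
        ((1 - th) * c) • ![2, 2, 1, 0] + (th * a) • ![1, 1, 1, 3] + (th * b) • ![2, 1, 1, 4] +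
        (th * c) • ![2, 2, 1, 5] → y = 0 ∨ y ∈ cone := by
    rintro a b c th ha hb hc ht ht' y rfl
    have ht'' : 0 ≤ 1 - th := by linarith
    exact hadd (hadd (hadd (hadd (hadd (hsmul (mul_nonneg ht'' ha) v1)
      (hsmul (mul_nonneg ht'' hb) v2)) (hsmul (mul_nonneg ht'' hc) v3))
      (hsmul (mul_nonneg ht ha) v4)) (hsmul (mul_nonneg ht hb) v5)) (hsmul (mul_nonneg ht hc) v6)
  refine (key (2 * x 2 - x 0) (x 0 - x 1) (x 1 - x 2) (x 3 / s) (by linarith) (by linarith)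
    (by linarith) hth0 hth x ?_).resolve_left h0
  have hss : x 3 / s * s = x 3 := div_mul_cancel₀ _ hs0.ne'
  ext i
  fin_cases i
  · simp; ring
  · simp; ring
  · simp; ring
  · simp
    rw [hs] at hss ⊢
    linear_combination -hss

lemma convex_cone : Convex ℝ cone := by
  intro x hx y hy a b ha hb hab
  rcases ha.eq_or_lt with rfl | ha
  · rw [zero_add] at hab
    simpa [hab] using hy
  · exact add_mem_cone_of_mem_tits (smul_mem_cone hx ha) (smul_mem_tits (cone_subset_tits hy) hb)

lemma exists_act_mem_prism {x : Vec 3} (hx : x ∈ cone) : ∃ g ∈ Gam, act g x ∈ prism := by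
  obtain ⟨g, hg, p, hp, rfl⟩ := cone_subset_tits hx
  exact ⟨g⁻¹, inv_mem hg, by rwa [act_inv_act]⟩

/-! ### The closed cone -/

lemma zero_mem_closure : (0 : Vec 3) ∈ closure cone := by
  have hc : Filter.Tendsto (fun t : ℝ => t • basePt) (nhdsWithin 0 (Set.Ioi 0))
      (nhds ((0 : ℝ) • basePt)) :=
    ((continuous_id.smul continuous_const).tendsto 0).mono_left nhdsWithin_le_nhds
  rw [zero_smul] at hc
  exact mem_closure_of_tendsto hc (Filter.eventually_of_mem self_mem_nhdsWithin
    fun t ht => smul_mem_cone basePt_mem_cone ht)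

lemma add_mem_cone_of_mem_closure {x y : Vec 3} (hx : x ∈ cone) (hy : y ∈ closure cone) :
    x + y ∈ cone := by
  have ho : IsOpen ((fun d => x + (y - d)) ⁻¹' cone) :=
    isOpen_cone.preimage (by fun_prop)
  obtain ⟨d, hd, hd'⟩ := mem_closure_iff.1 hy _ ho (by simpa using hx)
  have := add_mem_cone hd hd'
  simpa [add_assoc] using this

lemma act_mem_closure {g : GL (Fin 4) ℝ} (hg : g ∈ Gam) {x : Vec 3} (hx : x ∈ closure cone) :
    act g x ∈ closure cone :=
  map_mem_closure (continuous_act g) hx fun _ h => act_mem_cone hg h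

lemma smul_mem_closure {x : Vec 3} (hx : x ∈ closure cone) {t : ℝ} (ht : 0 ≤ t) :
    t • x ∈ closure cone := by
  rcases ht.eq_or_lt with rfl | ht
  · rw [zero_smul]
    exact zero_mem_closure
  · exact map_mem_closure (continuous_const_smul t) hx fun _ h => smul_mem_cone h ht

lemma add_mem_closure {x y : Vec 3} (hx : x ∈ closure cone) (hy : y ∈ closure cone) :
    x + y ∈ closure cone :=
  map_mem_closure₂ continuous_add hx hy fun _ h _ h' => add_mem_cone h h'

lemma abs_apply_le {x : Vec 3} (hx : x ∈ closure cone) (k : Fin 4) :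
    |x k| ≤ 10 * (hgt ⬝ᵥ x) := by
  have hcl : IsClosed {x : Vec 3 | |x k| ≤ 10 * (hgt ⬝ᵥ x)} :=
    isClosed_le (by fun_prop) (continuous_const.mul (continuous_const.dotProduct continuous_id))
  exact closure_minimal (fun y hy => abs_apply_le_of_mem_tits (cone_subset_tits hy) k) hcl hx

lemma eq_zero_of_mem_closure_of_neg_mem {x : Vec 3} (hx : x ∈ closure cone)
    (hx' : -x ∈ closure cone) : x = 0 := by
  have h1 := (abs_nonneg _).trans (abs_apply_le hx' 0)
  rw [dotProduct_neg] at h1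
  ext k
  have := abs_apply_le hx k
  exact abs_nonpos_iff.1 (by linarith)

lemma nonneg_of_mem_closure {φ : Vec 3 →ₗ[ℝ] ℝ} (h : ∀ x ∈ cone, 0 ≤ φ x) {x : Vec 3}
    (hx : x ∈ closure cone) : 0 ≤ φ x := by
  have hcl : IsClosed {x : Vec 3 | 0 ≤ φ x} :=
    isClosed_le continuous_const φ.continuous_of_finiteDimensional
  exact closure_minimal h hcl hx

lemma pos_of_mem_cone {φ : Vec 3 →ₗ[ℝ] ℝ} (h : ∀ x ∈ cone, 0 ≤ φ x) (h0 : φ ≠ 0) {x : Vec 3}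
    (hx : x ∈ cone) : 0 < φ x := by
  obtain ⟨y, hy⟩ : ∃ y, φ y < 0 := by
    by_contra hcon
    push Not at hcon
    apply h0
    refine LinearMap.ext fun y => ?_
    have h1 := hcon y
    have h2 := hcon (-y)
    rw [map_neg] at h2
    exact le_antisymm (neg_nonneg.1 h2) h1
  have hc : Filter.Tendsto (fun t : ℝ => x + t • y) (nhdsWithin 0 (Set.Ioi 0))
      (nhds (x + (0 : ℝ) • y)) :=
    ((continuous_const.add (continuous_id.smul continuous_const)).tendsto 0).mono_left
      nhdsWithin_le_nhds
  rw [zero_smul, add_zero] at hc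
  obtain ⟨t, ht, ht0⟩ := ((hc.eventually (isOpen_cone.mem_nhds hx)).and
    self_mem_nhdsWithin).exists
  have h1 := h _ ht
  rw [map_add, map_smul, smul_eq_mul] at h1
  have := mul_neg_of_pos_of_neg (show (0 : ℝ) < t from ht0) hy
  linarith

/-! ### The projectivized domain -/

/-- The projectivization map on nonzero vectors. -/
def proj (v : {v : Vec 3 // v ≠ 0}) : RP 3 := Projectivization.mk ℝ v.1 v.2

lemma proj_eq_iff (v w : {v : Vec 3 // v ≠ 0}) :
    proj v = proj w ↔ ∃ c : ℝ, c ≠ 0 ∧ v.1 = c • w.1 := by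
  rw [proj, proj, Projectivization.mk_eq_mk_iff']
  constructor
  · rintro ⟨c, hc⟩
    refine ⟨c, ?_, hc.symm⟩
    rintro rfl
    exact v.2 (by rw [← hc, zero_smul])
  · rintro ⟨c, -, hc⟩
    exact ⟨c, hc.symm⟩

lemma continuous_proj : Continuous proj := continuous_quotient_mk'

lemma isOpenMap_proj : IsOpenMap proj := by
  intro U hU
  have hq : Topology.IsQuotientMap proj := isQuotientMap_quotient_mk'
  rw [← hq.isOpen_preimage]
  have : proj ⁻¹' (proj '' U) = ⋃ c : {c : ℝ // c ≠ 0},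
      (fun v : {v : Vec 3 // v ≠ 0} =>
        (⟨c.1 • v.1, smul_ne_zero c.2 v.2⟩ : {v : Vec 3 // v ≠ 0})) ⁻¹' U := by
    ext v
    simp only [Set.mem_preimage, Set.mem_image, Set.mem_iUnion]
    constructor
    · rintro ⟨w, hw, h⟩
      obtain ⟨c, hc, hcw⟩ := (proj_eq_iff _ _).1 h
      exact ⟨⟨c, hc⟩, by simpa [← hcw] using hw⟩
    · rintro ⟨c, hc⟩
      exact ⟨_, hc, (proj_eq_iff _ _).2 ⟨c.1, c.2, rfl⟩⟩
  rw [this]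
  exact isOpen_iUnion fun c => hU.preimage (by fun_prop)

/-- The convex domain. -/
def Omg : Set (RP 3) := projOfCone cone

lemma ne_zero_of_mem_cone {v : Vec 3} (hv : v ∈ cone) : v ≠ 0 := by
  rintro rfl
  exact zero_notMem_cone hv

lemma mk_mem_Omg_iff {v : Vec 3} (hv : v ≠ 0) :
    Projectivization.mk ℝ v hv ∈ Omg ↔ v ∈ cone ∨ -v ∈ cone := by
  constructor
  · rintro ⟨w, hw, hwC, h⟩
    obtain ⟨c, hc, hcw⟩ := (proj_eq_iff ⟨v, hv⟩ ⟨w, hw⟩).1 h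
    simp only at hcw
    rcases hc.lt_or_gt with hc | hc
    · right
      rw [hcw, ← neg_smul]
      exact smul_mem_cone hwC (by linarith)
    · left
      rw [hcw]
      exact smul_mem_cone hwC hc
  · rintro (h | h)
    · exact ⟨v, hv, h, rfl⟩
    · refine ⟨-v, neg_ne_zero.2 hv, h, ?_⟩
      exact (proj_eq_iff ⟨v, hv⟩ ⟨-v, neg_ne_zero.2 hv⟩).2 ⟨-1, by norm_num, by simp⟩

lemma mk_mem_frontier_iff {v : Vec 3} (hv : v ≠ 0) :
    Projectivization.mk ℝ v hv ∈ frontier Omg ↔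
      (v ∈ closure cone ∨ -v ∈ closure cone) ∧ v ∉ cone ∧ -v ∉ cone := by
  have h1 : Projectivization.mk ℝ v hv ∈ frontier Omg ↔
      (⟨v, hv⟩ : {v : Vec 3 // v ≠ 0}) ∈ proj ⁻¹' frontier Omg := Iff.rfl
  have h2 : proj ⁻¹' Omg = Subtype.val ⁻¹' (cone ∪ -cone) := by
    ext w
    exact mk_mem_Omg_iff w.2
  have hopen : IsOpen {v : Vec 3 | v ≠ 0} := isOpen_ne
  have h3 : Subtype.val ⁻¹' frontier (cone ∪ -cone) =
      frontier (Subtype.val ⁻¹' (cone ∪ -cone) : Set {v : Vec 3 // v ≠ 0}) :=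
    hopen.isOpenMap_subtype_val.preimage_frontier_eq_frontier_preimage continuous_subtype_val _
  rw [h1, isOpenMap_proj.preimage_frontier_eq_frontier_preimage continuous_proj, h2, ← h3,
    Set.mem_preimage, (isOpen_cone.union isOpen_cone.neg).frontier_eq, closure_union, ← neg_closure]
  simp only [Set.mem_sdiff, Set.mem_union, Set.mem_neg, not_or]

lemma isProperCone_cone : IsProperCone cone := by
  refine ⟨⟨basePt, basePt_mem_cone⟩, isOpen_cone, convex_cone, fun x hx t ht =>
    smul_mem_cone hx ht, ?_⟩
  rintro ⟨x, v, hv, h⟩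
  apply hv
  have hlim : ∀ s : ℝ, s • v ∈ closure cone := by
    intro s
    have hc : Filter.Tendsto (fun t : ℝ => t • x + s • v) (nhdsWithin 0 (Set.Ioi 0))
        (nhds ((0 : ℝ) • x + s • v)) :=
      (((continuous_id.smul continuous_const).add continuous_const).tendsto 0).mono_left
        nhdsWithin_le_nhds
    rw [zero_smul, zero_add] at hc
    refine mem_closure_of_tendsto hc (Filter.eventually_of_mem self_mem_nhdsWithin fun t ht => ?_)
    have ht' : (0 : ℝ) < t := ht
    have := smul_mem_cone (h (t⁻¹ * s)) ht'
    rwa [smul_add, smul_smul, mul_inv_cancel_left₀ ht'.ne'] at this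
  apply eq_zero_of_mem_closure_of_neg_mem
  · simpa using hlim 1
  · simpa using hlim (-1)

lemma projMap_mk (g : GL (Fin 4) ℝ) {v : Vec 3} (hv : v ≠ 0) (hgv : act g v ≠ 0) :
    projMap g (Projectivization.mk ℝ v hv) = Projectivization.mk ℝ (act g v) hgv := rfl

lemma act_ne_zero (g : GL (Fin 4) ℝ) {v : Vec 3} (hv : v ≠ 0) : act g v ≠ 0 := by
  intro h
  apply hv
  rw [← act_inv_act g v, h, map_zero]

lemma preservesDomain : PreservesDomain Gam Omg := by
  have h : ∀ γ ∈ Gam, projMap γ '' Omg ⊆ Omg := by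
    rintro γ hγ _ ⟨_, ⟨v, hv, hvC, rfl⟩, rfl⟩
    exact ⟨act γ v, act_ne_zero γ hv, act_mem_cone hγ hvC, rfl⟩
  intro γ hγ
  refine (h γ hγ).antisymm ?_
  rintro _ ⟨v, hv, hvC, rfl⟩
  refine ⟨Projectivization.mk ℝ (act γ⁻¹ v) (act_ne_zero _ hv),
    ⟨_, _, act_mem_cone (inv_mem hγ) hvC, rfl⟩, ?_⟩
  rw [projMap_mk γ _ (act_ne_zero _ (act_ne_zero _ hv))]
  congr 1
  exact act_act_inv γ v

/-! ### Discreteness -/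

lemma det_sq {g : GL (Fin 4) ℝ} (hg : g ∈ Gam) :
    (g : Matrix (Fin 4) (Fin 4) ℝ).det ^ 2 = 1 := by
  induction hg using Subgroup.closure_induction with
  | mem x hx =>
    obtain ⟨i, rfl⟩ := hx
    have h := congrArg Matrix.det (reflMat_mul_self i)
    rw [Matrix.det_mul, Matrix.det_one] at h
    rw [sq]
    exact h
  | one => simp
  | mul x y _ _ hx hy => rw [Units.val_mul, Matrix.det_mul, mul_pow, hx, hy, one_mul]
  | inv x _ hx =>
    have h : ((x⁻¹ : GL (Fin 4) ℝ) : Matrix (Fin 4) (Fin 4) ℝ).det *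
        (x : Matrix (Fin 4) (Fin 4) ℝ).det = 1 := by
      rw [← Matrix.det_mul, ← Units.val_mul, inv_mul_cancel, Units.val_one, Matrix.det_one]
    have h2 := congrArg (· ^ 2) h
    simp only [mul_pow, hx] at h2
    linarith

lemma detPM1_of_mem {g : GL (Fin 4) ℝ} (hg : g ∈ Gam) : detPM1 g :=
  mul_self_eq_one_iff.1 (by rw [← sq]; exact det_sq hg)

lemma eq_one_of_form_pos {g : GL (Fin 4) ℝ} (hg : g ∈ Gam)
    (h : ∀ i, 0 < form i ⬝ᵥ act g basePt) : g = 1 := by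
  by_contra h1
  obtain ⟨i, w, hw, hgw, hl⟩ := exists_descent hg h1
  have h2 : 0 ≤ form i ⬝ᵥ act w basePt :=
    form_act_nonneg_of_len_le hw (by rw [← hgw]; omega) fun k => (form_basePt_pos k).le
  have h3 := h i
  rw [hgw, act_mul, form_act_refl, cartan_self] at h3
  linarith

lemma continuous_act_apply (x : Vec 3) : Continuous fun g : GL (Fin 4) ℝ => act g x :=
  Units.continuous_val.matrix_mulVec continuous_const

lemma discreteTopology_Gam : DiscreteTopology Gam := by
  apply discreteTopology_of_isOpen_singleton_one
  have : ({1} : Set Gam) = Subtype.val ⁻¹' {g : GL (Fin 4) ℝ | ∀ i, 0 < form i ⬝ᵥ act g basePt} := by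
    ext g
    simp only [Set.mem_singleton_iff, Set.mem_preimage, Set.mem_ofPred_eq]
    constructor
    · rintro rfl i
      rw [Subgroup.coe_one, act_one]
      exact form_basePt_pos i
    · intro h
      exact Subtype.ext (eq_one_of_form_pos g.2 h)
  rw [this, Set.ofPred_forall]
  exact (isOpen_iInter_of_finite fun i =>
    isOpen_lt continuous_const (continuous_const.dotProduct (continuous_act_apply _))).preimage
      continuous_subtype_val

lemma finite_of_bounded (R : ℝ) : {γ : Gam | ∀ i j,
    |((γ : GL (Fin 4) ℝ) : Matrix (Fin 4) (Fin 4) ℝ) i j| ≤ R ∧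
    |(((γ : GL (Fin 4) ℝ)⁻¹ : GL (Fin 4) ℝ) : Matrix (Fin 4) (Fin 4) ℝ) i j| ≤ R}.Finite := by
  have := discreteTopology_Gam
  have hcl : IsClosed (Gam : Set (GL (Fin 4) ℝ)) := Subgroup.isClosed_of_discrete
  have hK : IsCompact {g : GL (Fin 4) ℝ | ∀ i j, |(g : Matrix (Fin 4) (Fin 4) ℝ) i j| ≤ R ∧
      |((g⁻¹ : GL (Fin 4) ℝ) : Matrix (Fin 4) (Fin 4) ℝ) i j| ≤ R} := by
    have hB : IsCompact {M : Matrix (Fin 4) (Fin 4) ℝ | ∀ i j, |M i j| ≤ R} := by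
      have := isCompact_univ_pi (s := fun _ : Fin 4 => Set.univ.pi fun _ : Fin 4 => Set.Icc (-R) R)
        fun _ => isCompact_univ_pi fun _ => isCompact_Icc
      have e : {M : Matrix (Fin 4) (Fin 4) ℝ | ∀ i j, |M i j| ≤ R} =
          Set.univ.pi fun _ : Fin 4 => Set.univ.pi fun _ : Fin 4 => Set.Icc (-R) R :=
        Set.ext fun M =>
          ⟨fun h i _ j _ => abs_le.1 (h i j), fun h i j => abs_le.2 (h i trivial j trivial)⟩
      rw [e]
      exact this
    have hBo : IsCompact (MulOpposite.unop ⁻¹' {M : Matrix (Fin 4) (Fin 4) ℝ | ∀ i j, |M i j| ≤ R}) :=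
      MulOpposite.opHomeomorph.symm.isCompact_preimage.2 hB
    convert Units.isClosedEmbedding_embedProduct.isCompact_preimage (hB.prod hBo) using 1
    ext g
    simp only [Set.mem_ofPred_eq, Set.mem_preimage, Set.mem_prod, Units.embedProduct_apply,
      MulOpposite.unop_op]
    exact ⟨fun h => ⟨fun i j => (h i j).1, fun i j => (h i j).2⟩,
      fun h i j => ⟨h.1 i j, h.2 i j⟩⟩
  have hK' := hcl.isClosedEmbedding_subtypeVal.isCompact_preimage hK
  exact hK'.finite_of_discrete

/-! ### Proper discontinuity and cocompactness -/

lemma act_single (g : GL (Fin 4) ℝ) (i j : Fin 4) :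
    act g (Pi.single j 1) i = (g : Matrix (Fin 4) (Fin 4) ℝ) i j := by
  simp [act]

lemma exists_entry_bound {K : Set (Vec 3)} (hK : IsCompact K) (hKC : K ⊆ cone) :
    ∃ B : ℝ, 0 < B ∧ ∀ g ∈ Gam, ∀ k ∈ K, ∀ k' ∈ K, ∀ c : ℝ, 0 < c → act g k = c • k' →
      ∀ i j, |(g : Matrix (Fin 4) (Fin 4) ℝ) i j| ≤ c * B := by
  obtain ⟨δ, hδ, hsub⟩ := hK.exists_cthickening_subset_open isOpen_cone hKC
  obtain ⟨M, hM⟩ := hK.exists_bound_of_continuousOn (f := fun x : Vec 3 => hgt ⬝ᵥ x)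
    (continuous_const.dotProduct continuous_id).continuousOn
  refine ⟨20 * |M| / δ + 1, by positivity, fun g hg k hk k' hk' c hc h i j => ?_⟩
  set e := act g (Pi.single j 1) with he
  have hmem : ∀ s : ℝ, |s| = δ → c • k' + s • e ∈ cone := by
    intro s hs
    rw [← h, he, ← map_smul, ← map_add]
    refine act_mem_cone hg (hsub (Metric.mem_cthickening_of_dist_le _ _ _ _ hk ?_))
    rw [dist_eq_norm, add_sub_cancel_left, norm_smul, Pi.norm_single]
    simp [hs]
  have h1 := hmem δ (abs_of_pos hδ)
  have h2 := hmem (-δ) (by rw [abs_neg, abs_of_pos hδ])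
  have p1 := hgt_pos h1
  have p2 := hgt_pos h2
  have q1 := abs_apply_le_of_mem_tits (cone_subset_tits h1) i
  have q2 := abs_apply_le_of_mem_tits (cone_subset_tits h2) i
  have hM' : hgt ⬝ᵥ k' ≤ |M| := (le_abs_self _).trans ((hM k' hk').trans (le_abs_self _))
  have hcM := mul_le_mul_of_nonneg_left hM' hc.le
  simp only [dotProduct_add, dotProduct_smul, smul_eq_mul, Pi.add_apply, Pi.smul_apply] at p1 p2 q1 q2
  rw [abs_le] at q1 q2
  have hb : |δ * e i| ≤ 20 * (c * |M|) := by
    rw [abs_le]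
    constructor <;> linarith [q1.1, q1.2, q2.1, q2.2]
  rw [abs_mul, abs_of_pos hδ, ← le_div_iff₀' hδ] at hb
  rw [← act_single]
  calc |e i| ≤ 20 * (c * |M|) / δ := hb
    _ = c * (20 * |M| / δ) := by ring
    _ ≤ c * (20 * |M| / δ + 1) := by gcongr; linarith

lemma le_of_entry_bound {g : GL (Fin 4) ℝ} (hg : g ∈ Gam) {x : ℝ}
    (h : ∀ i j, |(g : Matrix (Fin 4) (Fin 4) ℝ) i j| ≤ x) : 1 ≤ 24 * x := by
  have hx : 0 ≤ x := (abs_nonneg _).trans (h 0 0)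
  have hd := Matrix.det_le (A := (g : Matrix (Fin 4) (Fin 4) ℝ)) (abv := AbsoluteValue.abs) h
  have h1 : |(g : Matrix (Fin 4) (Fin 4) ℝ).det| = 1 := by
    rcases detPM1_of_mem hg with h | h <;> rw [h] <;> simp
  have hf : Nat.factorial 4 = 24 := rfl
  simp only [AbsoluteValue.abs_apply, h1, Fintype.card_fin, hf, nsmul_eq_mul] at hd
  push_cast at hd
  by_contra hlt
  push Not at hlt
  have h4 : x ^ 4 ≤ x := pow_le_of_le_one hx (by linarith) (by norm_num)
  linarith

lemma exists_compact_lift {K : Set (RP 3)} (hK : IsCompact K) (hKO : K ⊆ Omg) :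
    ∃ L : Set (Vec 3), IsCompact L ∧ L ⊆ cone ∧
      ∀ P ∈ K, ∃ v ∈ L, ∃ hv : v ≠ 0, P = Projectivization.mk ℝ v hv := by
  refine hK.induction_on (p := fun K => ∃ L : Set (Vec 3), IsCompact L ∧ L ⊆ cone ∧
      ∀ P ∈ K, ∃ v ∈ L, ∃ hv : v ≠ 0, P = Projectivization.mk ℝ v hv) ?_ ?_ ?_ ?_
  · exact ⟨∅, isCompact_empty, Set.empty_subset _, by simp⟩
  · rintro s t hst ⟨L, hL, hLC, h⟩
    exact ⟨L, hL, hLC, fun P hP => h P (hst hP)⟩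
  · rintro s t ⟨L, hL, hLC, h⟩ ⟨L', hL', hLC', h'⟩
    refine ⟨L ∪ L', hL.union hL', Set.union_subset hLC hLC', ?_⟩
    rintro P (hP | hP)
    · obtain ⟨v, hv, r⟩ := h P hP
      exact ⟨v, Or.inl hv, r⟩
    · obtain ⟨v, hv, r⟩ := h' P hP
      exact ⟨v, Or.inr hv, r⟩
  · intro P hP
    obtain ⟨v, hv, hvC, rfl⟩ := hKO hP
    obtain ⟨L, hL, hvL, hLC⟩ := exists_compact_subset isOpen_cone hvC
    refine ⟨proj '' (Subtype.val ⁻¹' interior L), mem_nhdsWithin_of_mem_nhds ?_, L, hL, hLC, ?_⟩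
    · exact (isOpenMap_proj _ (isOpen_interior.preimage continuous_subtype_val)).mem_nhds
        ⟨⟨v, hv⟩, hvL, rfl⟩
    · rintro _ ⟨w, hw, rfl⟩
      exact ⟨w.1, interior_subset hw, w.2, rfl⟩

lemma properlyDiscontinuousOn : ProperlyDiscontinuousOn Gam Omg := by
  intro K hKO hK
  obtain ⟨L, hL, hLC, hlift⟩ := exists_compact_lift hK hKO
  obtain ⟨B, hB, hbd⟩ := exists_entry_bound hL hLC
  refine (finite_of_bounded (24 * B * B)).subset ?_
  rintro ⟨g, hg⟩ ⟨_, ⟨P, hP, rfl⟩, hgP⟩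
  obtain ⟨k, hk, hk0, rfl⟩ := hlift P hP
  obtain ⟨k', hk', hk0', h⟩ := hlift _ hgP
  rw [projMap_mk g hk0 (act_ne_zero g hk0)] at h
  obtain ⟨c, hc0, hc⟩ := (proj_eq_iff ⟨_, act_ne_zero g hk0⟩ ⟨k', hk0'⟩).1 h
  simp only at hc
  have hcpos : 0 < c := by
    by_contra hneg
    have hneg' : 0 < -c := by
      rcases hc0.lt_or_gt with h | h
      · linarith
      · exact absurd h hneg
    have h1 := add_mem_cone (act_mem_cone hg (hLC hk)) (smul_mem_cone (hLC hk') hneg')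
    rw [hc, ← add_smul, add_neg_cancel, zero_smul] at h1
    exact zero_notMem_cone h1
  have hinv : act g⁻¹ k' = c⁻¹ • k := by
    rw [← act_inv_act g k, hc, map_smul, smul_smul, inv_mul_cancel₀ hc0, one_smul]
  have b1 := hbd g hg k hk k' hk' c hcpos hc
  have b2 := hbd g⁻¹ (inv_mem hg) k' hk' k hk c⁻¹ (inv_pos.2 hcpos) hinv
  have d1 := le_of_entry_bound hg b1
  have d2 := le_of_entry_bound (inv_mem hg) b2
  have c1 : c ≤ 24 * B := by
    have := mul_le_mul_of_nonneg_left d2 hcpos.le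
    rw [mul_one] at this
    calc c ≤ c * (24 * (c⁻¹ * B)) := this
      _ = 24 * B := by field_simp
  have c2 : c⁻¹ ≤ 24 * B := by
    have := mul_le_mul_of_nonneg_left d1 (inv_pos.2 hcpos).le
    rw [mul_one] at this
    calc c⁻¹ ≤ c⁻¹ * (24 * (c * B)) := this
      _ = 24 * B := by field_simp
  exact fun i j => ⟨(b1 i j).trans (by gcongr), (b2 i j).trans (by gcongr)⟩

/-- The compact slice of the prism at height one. -/
def slice : Set (Vec 3) := {x | x ∈ prism ∧ hgt ⬝ᵥ x = 1}

lemma isClosed_prism : IsClosed prism := by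
  have : prism = ⋂ i, {x | 0 ≤ form i ⬝ᵥ x} := by
    ext x
    simp [prism]
  rw [this]
  exact isClosed_iInter fun i =>
    isClosed_le continuous_const (continuous_const.dotProduct continuous_id)

lemma isCompact_slice : IsCompact slice := by
  refine Metric.isCompact_of_isClosed_isBounded ?_ ?_
  · exact isClosed_prism.inter
      (isClosed_eq (continuous_const.dotProduct continuous_id) continuous_const)
  · refine (Metric.isBounded_closedBall (x := (0 : Vec 3)) (r := 10)).subset fun x hx => ?_
    rw [mem_closedBall_zero_iff, pi_norm_le_iff_of_nonneg (by norm_num)]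
    intro k
    have := abs_apply_le_of_mem_tits (prism_subset_tits hx.1) k
    rwa [hx.2, mul_one] at this

lemma slice_subset_cone : slice ⊆ cone := by
  rintro x ⟨hx, h1⟩
  refine mem_cone_of_mem_prism hx ?_
  rintro rfl
  simp at h1

lemma cocompactOn : CocompactOn Gam Omg := by
  have hc : IsCompact (Subtype.val ⁻¹' slice : Set {v : Vec 3 // v ≠ 0}) := by
    have e : Subtype.val '' (Subtype.val ⁻¹' slice : Set {v : Vec 3 // v ≠ 0}) = slice :=
      Set.image_preimage_eq_of_subset fun x hx =>
        ⟨⟨x, ne_zero_of_mem_cone (slice_subset_cone hx)⟩, rfl⟩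
    rw [Subtype.isCompact_iff, e]
    exact isCompact_slice
  refine ⟨proj '' (Subtype.val ⁻¹' slice), hc.image continuous_proj, ?_, ?_⟩
  · rintro _ ⟨v, hv, rfl⟩
    exact (mk_mem_Omg_iff v.2).2 (Or.inl (slice_subset_cone hv))
  · apply Set.Subset.antisymm
    · refine Set.iUnion₂_subset fun γ hγ => ?_
      refine Set.Subset.trans (Set.image_mono ?_) (preservesDomain γ hγ).subset
      rintro _ ⟨v, hv, rfl⟩
      exact (mk_mem_Omg_iff v.2).2 (Or.inl (slice_subset_cone hv))
    · rintro _ ⟨v, hv, hvC, rfl⟩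
      obtain ⟨g, hg, hgv⟩ := exists_act_mem_prism hvC
      have hpos := hgt_pos (act_mem_cone hg hvC)
      set t := (hgt ⬝ᵥ act g v)⁻¹ with ht
      have ht0 : 0 < t := inv_pos.2 hpos
      have hs : t • act g v ∈ slice := by
        refine ⟨smul_mem_prism hgv ht0.le, ?_⟩
        rw [dotProduct_smul, smul_eq_mul, ht, inv_mul_cancel₀ hpos.ne']
      refine Set.mem_iUnion₂.2 ⟨g⁻¹, inv_mem hg, proj ⟨t • act g v,
        ne_zero_of_mem_cone (slice_subset_cone hs)⟩, ⟨_, hs, rfl⟩, ?_⟩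
      refine (proj_eq_iff ⟨act g⁻¹ (t • act g v), act_ne_zero _ (ne_zero_of_mem_cone
        (slice_subset_cone hs))⟩ ⟨v, hv⟩).2 ⟨t, ht0.ne', ?_⟩
      simp only
      rw [map_smul, act_inv_act]

lemma divides_Gam : Divides Gam Omg :=
  ⟨fun _ => detPM1_of_mem, discreteTopology_Gam, preservesDomain, properlyDiscontinuousOn,
    cocompactOn⟩

/-! ### The invariant triangle -/

/-- Elements of the group that are diagonal in the standard basis. -/
def dil : Fin 3 → GL (Fin 4) ℝ :=
  let t := refl 0 * refl 1 * refl 0 * refl 2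
  let d := t * (refl 0 * t * refl 0)
  ![refl 0 * (refl 1 * d * refl 1) * refl 0, refl 1 * d * refl 1, d]

lemma dil_mem (i : Fin 3) : dil i ∈ Gam := by
  have h := refl_mem
  have ht : refl 0 * refl 1 * refl 0 * refl 2 ∈ Gam :=
    mul_mem (mul_mem (mul_mem (h 0) (h 1)) (h 0)) (h 2)
  have hd := mul_mem ht (mul_mem (mul_mem (h 0) ht) (h 0))
  have hd' := mul_mem (mul_mem (h 1) hd) (h 1)
  fin_cases i
  · exact mul_mem (mul_mem (h 0) hd') (h 0)
  · exact hd'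
  · exact hd

/-- The vertices of the invariant triangle. -/
def ver (i : Fin 3) : Vec 3 := Pi.single i.castSucc 1

lemma ver_eq : ver = ![![1, 0, 0, 0], ![0, 1, 0, 0], ![0, 0, 1, 0]] := by
  ext i j
  fin_cases i <;> fin_cases j <;> simp [ver]

lemma act_dil (i : Fin 3) (x : Vec 3) : act (dil i) x =
    (1 / 2 : ℝ) • x + (7 / 2 * x i.castSucc) • ver i + (1 / 2 * x 3) • Pi.single 3 1 := by
  rw [vec_eta x]
  fin_cases i <;>
  · simp only [dil, Fin.zero_eta, Fin.mk_one, Fin.reduceFinMk, Matrix.cons_val, act_mul,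
      act_refl_zero, act_refl_one, act_refl_two]
    ext k
    fin_cases k <;> simp [ver_eq] <;> ring

lemma ver_apply_self (i : Fin 3) : ver i i.castSucc = 1 := by simp [ver]

lemma ver_apply_three (i : Fin 3) : ver i 3 = 0 := by
  fin_cases i <;> simp [ver_eq]

lemma act_dil_pow (i : Fin 3) (n : ℕ) (x : Vec 3) : act (dil i ^ n) x =
    ((1 / 2 : ℝ) ^ n) • x + ((4 ^ n - (1 / 2) ^ n) * x i.castSucc) • ver i +
      ((1 - (1 / 2) ^ n) * x 3) • Pi.single 3 1 := by
  induction n with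
  | zero => simp [act_one]
  | succ n ih =>
    have h1 : ver i i.castSucc = 1 := ver_apply_self i
    have h2 : ver i 3 = 0 := ver_apply_three i
    have h3 : (Pi.single 3 1 : Vec 3) i.castSucc = 0 := by fin_cases i <;> simp
    rw [pow_succ', act_mul, ih, act_dil]
    simp only [Pi.add_apply, Pi.smul_apply, smul_eq_mul, h1, h2, h3, Pi.single_eq_same]
    match_scalars <;> ring

lemma tendsto_dil (i : Fin 3) (x : Vec 3) :
    Filter.Tendsto (fun n => ((1 / 4 : ℝ) ^ n) • act (dil i ^ n) x) Filter.atTop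
      (nhds (x i.castSucc • ver i)) := by
  have e : ∀ n, ((1 / 4 : ℝ) ^ n) • act (dil i ^ n) x = ((1 / 8 : ℝ) ^ n) • x +
      ((1 - (1 / 8) ^ n) * x i.castSucc) • ver i +
      (((1 / 4) ^ n - (1 / 8) ^ n) * x 3) • Pi.single 3 1 := by
    intro n
    have h1 : (1 / 4 : ℝ) ^ n * (1 / 2) ^ n = (1 / 8) ^ n := by rw [← mul_pow]; norm_num
    have h2 : (1 / 4 : ℝ) ^ n * 4 ^ n = 1 := by rw [← mul_pow]; norm_num
    have h3 : (1 / 4 : ℝ) ^ n * ((4 ^ n - (1 / 2) ^ n) * x i.castSucc) =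
        (1 - (1 / 8) ^ n) * x i.castSucc := by
      rw [← h1]
      linear_combination (x i.castSucc) * h2
    have h4 : (1 / 4 : ℝ) ^ n * ((1 - (1 / 2) ^ n) * x 3) =
        ((1 / 4) ^ n - (1 / 8) ^ n) * x 3 := by
      rw [← h1]
      ring
    rw [act_dil_pow, smul_add, smul_add, smul_smul, smul_smul, smul_smul, h1, h3, h4]
  simp only [e]
  have p8 := tendsto_pow_atTop_nhds_zero_of_lt_one (r := (1 / 8 : ℝ)) (by norm_num) (by norm_num)
  have p4 := tendsto_pow_atTop_nhds_zero_of_lt_one (r := (1 / 4 : ℝ)) (by norm_num) (by norm_num)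
  have := ((p8.smul_const x).add ((((tendsto_const_nhds (x := (1 : ℝ))).sub p8).mul_const
    (x i.castSucc)).smul_const (ver i))).add (((p4.sub p8).mul_const (x 3)).smul_const
      (Pi.single 3 1 : Vec 3))
  simpa using this

lemma apply_smul_ver_mem_closure {x : Vec 3} (hx : x ∈ closure cone) (i : Fin 3) :
    x i.castSucc • ver i ∈ closure cone :=
  isClosed_closure.mem_of_tendsto (tendsto_dil i x) (Filter.Eventually.of_forall fun n =>
    smul_mem_closure (act_mem_closure (pow_mem (dil_mem i) n) hx) (by positivity))

lemma ver_mem_closure (i : Fin 3) : ver i ∈ closure cone := by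
  have := apply_smul_ver_mem_closure (subset_closure prism_vertices_mem_cone.1) i
  fin_cases i <;> simpa using this

lemma ver_ne_zero (i : Fin 3) : ver i ≠ 0 := by simp [ver]

lemma apply_nonneg {x : Vec 3} (hx : x ∈ closure cone) (i : Fin 3) : 0 ≤ x i.castSucc := by
  by_contra h
  push Not at h
  apply ver_ne_zero i
  apply eq_zero_of_mem_closure_of_neg_mem (ver_mem_closure i)
  have := smul_mem_closure (apply_smul_ver_mem_closure hx i) (t := -(x i.castSucc)⁻¹)
    (neg_nonneg.2 (inv_nonpos.2 h.le))
  rwa [smul_smul, neg_mul, inv_mul_cancel₀ h.ne, neg_one_smul] at this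

lemma apply_pos {x : Vec 3} (hx : x ∈ cone) (i : Fin 3) : 0 < x i.castSucc := by
  refine pos_of_mem_cone (φ := LinearMap.proj i.castSucc)
    (fun y hy => apply_nonneg (subset_closure hy) i) ?_ hx
  intro h
  have := LinearMap.congr_fun h (ver i)
  simp [ver] at this

lemma apply_three_eq_zero {x : Vec 3} (hx : x ∈ closure cone) {i : Fin 3}
    (h : x i.castSucc = 0) : x 3 = 0 := by
  have hlim : x 3 • (Pi.single 3 1 : Vec 3) ∈ closure cone := by
    have p2 := tendsto_pow_atTop_nhds_zero_of_lt_one (r := (1 / 2 : ℝ)) (by norm_num) (by norm_num)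
    have ht : Filter.Tendsto (fun n => act (dil i ^ n) x) Filter.atTop
        (nhds (x 3 • (Pi.single 3 1 : Vec 3))) := by
      simp only [act_dil_pow, h, mul_zero, zero_smul, add_zero]
      have := (p2.smul_const x).add ((((tendsto_const_nhds (x := (1 : ℝ))).sub p2).mul_const
        (x 3)).smul_const (Pi.single 3 1 : Vec 3))
      simpa using this
    exact isClosed_closure.mem_of_tendsto ht (Filter.Eventually.of_forall fun n =>
      act_mem_closure (pow_mem (dil_mem i) n) hx)
  have h2 := act_mem_closure (refl_mem 4) hlim
  have e : act (refl 4) (x 3 • (Pi.single 3 1 : Vec 3)) = -(x 3 • (Pi.single 3 1 : Vec 3)) := by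
    rw [vec_eta (x 3 • (Pi.single 3 1 : Vec 3)), act_refl_four]
    simp
  rw [e] at h2
  have := congrFun (eq_zero_of_mem_closure_of_neg_mem hlim h2) 3
  simpa using this

lemma apply_single_three_eq_zero {φ : Vec 3 →ₗ[ℝ] ℝ} (h : ∀ x ∈ cone, 0 ≤ φ x) {i : Fin 3}
    (hi : φ (ver i) = 0) : φ (Pi.single 3 1) = 0 := by
  have key : ∀ x ∈ cone, 0 ≤ x 3 * φ (Pi.single 3 1) := by
    intro x hx
    have p2 := tendsto_pow_atTop_nhds_zero_of_lt_one (r := (1 / 2 : ℝ)) (by norm_num) (by norm_num)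
    have ht : Filter.Tendsto (fun n => φ (act (dil i ^ n) x)) Filter.atTop
        (nhds (x 3 * φ (Pi.single 3 1))) := by
      simp only [act_dil_pow, map_add, map_smul, hi, smul_zero, add_zero]
      have := (p2.smul_const (φ x)).add ((((tendsto_const_nhds (x := (1 : ℝ))).sub p2).mul_const
        (x 3)).smul_const (φ (Pi.single 3 1)))
      simpa using this
    exact ge_of_tendsto' ht fun n => h _ (act_mem_cone (pow_mem (dil_mem i) n) hx)
  have h1 := prism_vertices_mem_cone.2.2.2.1
  have k1 := key _ h1
  have k2 := key _ (act_mem_cone (refl_mem 4) h1)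
  rw [act_refl_four] at k2
  simp at k1 k2
  linarith

lemma mem_cone_of_pos {x : Vec 3} (h : ∀ i : Fin 3, 0 < x i.castSucc) (h3 : x 3 = 0) :
    x ∈ cone := by
  obtain ⟨e, he, h0, h1, h2⟩ : ∃ e > 0, e ≤ x 0 ∧ e ≤ x 1 ∧ e ≤ x 2 :=
    ⟨min (x 0) (min (x 1) (x 2)), lt_min (h 0) (lt_min (h 1) (h 2)), by simp, by simp, by simp⟩
  have hs := smul_mem_cone prism_vertices_mem_cone.1 he
  have := add_mem_cone_of_mem_closure hs (add_mem_closure (add_mem_closure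
    (smul_mem_closure (ver_mem_closure 0) (sub_nonneg.2 h0))
    (smul_mem_closure (ver_mem_closure 1) (sub_nonneg.2 h1)))
    (smul_mem_closure (ver_mem_closure 2) (sub_nonneg.2 h2)))
  convert this using 1
  ext k
  fin_cases k <;> simp [ver_eq, h3]

lemma not_isStrictlyConvexDomain : ¬ IsStrictlyConvexDomain Omg := by
  intro h
  refine h (ver 0) (ver 1) ?_ ?_
  · rw [LinearIndependent.pair_iff]
    intro s t hst
    have h0 := congrFun hst 0
    have h1 := congrFun hst 1
    simp [ver_eq] at h0 h1
    exact ⟨h0, h1⟩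
  · intro t ht hne
    rw [mk_mem_frontier_iff]
    have h2 : (t • ver 0 + (1 - t) • ver 1) (Fin.castSucc 2) = 0 := by simp [ver_eq]
    refine ⟨Or.inl (add_mem_closure (smul_mem_closure (ver_mem_closure 0) ht.1)
      (smul_mem_closure (ver_mem_closure 1) (by linarith [ht.2]))), ?_, ?_⟩
    · intro hc
      exact (apply_pos hc 2).ne' h2
    · intro hc
      have := apply_pos hc 2
      rw [Pi.neg_apply, h2] at this
      simp at this

/-! ### Strong irreducibility -/

lemma apply_smul_act_ver_mem {Δ : Subgroup (GL (Fin 4) ℝ)}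
    (hfin : (Δ.subgroupOf Gam).FiniteIndex) {W : Submodule ℝ (Vec 3)}
    (hW : ∀ γ ∈ Δ, ∀ x ∈ W, act γ x ∈ W) {g : GL (Fin 4) ℝ} (hg : g ∈ Gam) {x : Vec 3}
    (hx : x ∈ W) {i : Fin 3} (h : act g⁻¹ x i.castSucc ≠ 0) : act g (ver i) ∈ W := by
  have hm : g * dil i * g⁻¹ ∈ Gam := mul_mem (mul_mem hg (dil_mem i)) (inv_mem hg)
  obtain ⟨k, hk, -, hmem⟩ := Subgroup.exists_pow_mem_of_index_ne_zero hfin.index_ne_zero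
    (⟨_, hm⟩ : Gam)
  rw [Subgroup.mem_subgroupOf, Subgroup.coe_pow] at hmem
  have hlim : Filter.Tendsto (fun n => act g (((1 / 4 : ℝ) ^ (k * n)) •
      act (dil i ^ (k * n)) (act g⁻¹ x))) Filter.atTop
      (nhds (act g (act g⁻¹ x i.castSucc • ver i))) :=
    ((continuous_act g).tendsto _).comp ((tendsto_dil i _).comp
      (Filter.tendsto_id.const_mul_atTop' hk))
  have := W.closed_of_finiteDimensional.mem_of_tendsto hlim
    (Filter.Eventually.of_forall fun n => ?_)
  · rw [map_smul] at this
    exact (W.smul_mem_iff h).1 this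
  · rw [map_smul, ← act_mul, ← act_mul]
    refine W.smul_mem _ ?_
    have e : g * dil i ^ (k * n) * g⁻¹ = ((g * dil i * g⁻¹) ^ k) ^ n := by
      rw [← pow_mul, conj_pow]
    rw [e]
    exact hW _ (pow_mem hmem n) x hx

lemma stronglyIrreducible_Gam : StronglyIrreducible Gam := by
  intro Δ _ hfin W hW
  rw [or_iff_not_imp_left]
  intro hne
  have key : ∀ {g : GL (Fin 4) ℝ}, g ∈ Gam → ∀ {x : Vec 3}, x ∈ W → ∀ {i : Fin 3},
      act g⁻¹ x i.castSucc ≠ 0 → act g (ver i) ∈ W :=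
    fun hg _ hx _ h => apply_smul_act_ver_mem hfin hW hg hx h
  have key1 : ∀ {x : Vec 3}, x ∈ W → ∀ i : Fin 3, x i.castSucc ≠ 0 → ver i ∈ W := by
    intro x hx i h
    have := key (one_mem _) hx (i := i) (by rwa [inv_one, act_one])
    rwa [act_one] at this
  have key3 : ∀ {x : Vec 3}, x ∈ W → act (refl 3) x (Fin.castSucc 0) ≠ 0 →
      act (refl 3) (ver 0) ∈ W := by
    intro x hx h
    exact key (refl_mem 3) hx (by rwa [refl_inv])
  have e0 : act (refl 3) (ver 0) = ![3, 2, 2, 8] := by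
    rw [ver_eq]
    simp only [Matrix.cons_val]
    rw [act_refl_three]
    norm_num
  have main : (![3, 2, 2, 8] : Vec 3) ∈ W → W = ⊤ := by
    intro h
    have h0 := key1 h 0 (by simp)
    have h1 := key1 h 1 (by simp)
    have h2 := key1 h 2 (by simp)
    rw [eq_top_iff]
    intro x _
    have : x = (x 3 / 8) • (![3, 2, 2, 8] : Vec 3) + (x 0 - x 3 / 8 * 3) • ver 0 +
        (x 1 - x 3 / 8 * 2) • ver 1 + (x 2 - x 3 / 8 * 2) • ver 2 := by
      ext k
      fin_cases k <;> simp [ver_eq]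
    rw [this]
    exact W.add_mem (W.add_mem (W.add_mem (W.smul_mem _ h) (W.smul_mem _ h0)) (W.smul_mem _ h1))
      (W.smul_mem _ h2)
  rw [e0] at key3
  have main' : ∀ i : Fin 3, ver i ∈ W → W = ⊤ := by
    intro i hi
    refine main (key3 hi ?_)
    rw [ver_eq]
    fin_cases i <;> simp [act_refl_three] <;> norm_num
  obtain ⟨x, hx, hx0⟩ := W.ne_bot_iff.1 hne
  by_cases hc : ∃ i : Fin 3, x i.castSucc ≠ 0
  · obtain ⟨i, hi⟩ := hc
    exact main' i (key1 hx i hi)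
  · push Not at hc
    have c0 : x 0 = 0 := hc 0
    have c1 : x 1 = 0 := hc 1
    have c2 : x 2 = 0 := hc 2
    have c3 : x 3 ≠ 0 := by
      intro c3
      apply hx0
      rw [vec_eta x, c0, c1, c2, c3]
      simp
    refine main (key3 hx ?_)
    rw [vec_eta x, act_refl_three, c0, c1, c2]
    simpa using c3

/-! ### Zooming in at a boundary point -/

lemma exists_lim {X : Type*} [TopologicalSpace X] {K : Set X} (hK : IsCompact K) {v : ℕ → X}
    (h : ∀ n, v n ∈ K) :
    ∃ a ∈ K, Filter.Tendsto v (Filter.hyperfilter ℕ : Filter ℕ) (nhds a) :=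
  hK.ultrafilter_le_nhds ((Filter.hyperfilter ℕ).map v)
    (Filter.le_principal_iff.2 (Filter.mem_map.2 (Filter.Eventually.of_forall h)))

lemma exists_lim_functional {ψ : ℕ → Vec 3 →ₗ[ℝ] ℝ} {B : ℝ}
    (h : ∀ n k, |ψ n (Pi.single k 1)| ≤ B) : ∃ ψ' : Vec 3 →ₗ[ℝ] ℝ, ∀ y,
      Filter.Tendsto (fun n => ψ n y) (Filter.hyperfilter ℕ : Filter ℕ) (nhds (ψ' y)) := by
  obtain ⟨a, -, ha⟩ := exists_lim (isCompact_univ_pi fun _ : Fin 4 => isCompact_Icc)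
    (v := fun n k => ψ n (Pi.single k 1)) (fun n k _ => abs_le.1 (h n k))
  refine ⟨(Pi.basisFun ℝ (Fin 4)).constr ℝ a, fun y => ?_⟩
  have e : ∀ n, ψ n y = ∑ k, y k • ψ n (Pi.single k 1) := fun n => by
    conv_lhs => rw [← (Pi.basisFun ℝ (Fin 4)).sum_repr y]
    simp
  simp only [e, Module.Basis.constr_apply_fintype]
  refine tendsto_finsetSum _ fun k _ => ?_
  have := (tendsto_pi_nhds.1 ha k).const_smul (y k)
  simpa using this

lemma tendsto_functional_apply {F : Filter ℕ} {ψ : ℕ → Vec 3 →ₗ[ℝ] ℝ} {ψ' : Vec 3 →ₗ[ℝ] ℝ}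
    (h : ∀ y, Filter.Tendsto (fun n => ψ n y) F (nhds (ψ' y))) {v : ℕ → Vec 3} {v' : Vec 3}
    (hv : Filter.Tendsto v F (nhds v')) :
    Filter.Tendsto (fun n => ψ n (v n)) F (nhds (ψ' v')) := by
  have e : ∀ (χ : Vec 3 →ₗ[ℝ] ℝ) (y : Vec 3), χ y = ∑ k, y k * χ (Pi.single k 1) := fun χ y => by
    conv_lhs => rw [← (Pi.basisFun ℝ (Fin 4)).sum_repr y]
    simp
  have e1 : (fun n => ψ n (v n)) = fun n => ∑ k, v n k * ψ n (Pi.single k 1) :=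
    funext fun n => e _ _
  rw [e1, e ψ' v']
  exact tendsto_finsetSum _ fun k _ => (tendsto_pi_nhds.1 hv k).mul (h _)

/-- Points of the closed cone of bounded height. -/
def cap (c : ℝ) : Set (Vec 3) := {x | x ∈ closure cone ∧ hgt ⬝ᵥ x ≤ c}

lemma isCompact_cap (c : ℝ) : IsCompact (cap c) := by
  refine Metric.isCompact_of_isClosed_isBounded ?_ ?_
  · exact isClosed_closure.inter
      (isClosed_le (continuous_const.dotProduct continuous_id) continuous_const)
  · refine (Metric.isBounded_closedBall (x := (0 : Vec 3)) (r := 10 * |c|)).subset fun x hx => ?_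
    rw [mem_closedBall_zero_iff, pi_norm_le_iff_of_nonneg (by positivity)]
    intro k
    have := abs_apply_le hx.1 k
    rw [Real.norm_eq_abs]
    linarith [hx.2, le_abs_self c]

lemma hgt_nonneg {x : Vec 3} (hx : x ∈ closure cone) : 0 ≤ hgt ⬝ᵥ x := by
  have := (abs_nonneg _).trans (abs_apply_le hx 0)
  linarith

lemma mem_cap_of_add_mem_slice {x y : Vec 3} (hx : x ∈ closure cone) (hy : y ∈ closure cone)
    (h : x + y ∈ slice) : x ∈ cap 1 := by
  have h1 := h.2
  have h2 := hgt_nonneg hy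
  rw [dotProduct_add] at h1
  exact ⟨hx, by linarith⟩

lemma exists_zoom {x o : Vec 3} (hx : x ∈ closure cone) (ho : o ∈ cone) :
    ∃ (g : ℕ → GL (Fin 4) ℝ) (l : ℕ → ℝ), ∀ n, g n ∈ Gam ∧ 0 < l n ∧
      l n • act (g n) (x + (1 / ((n : ℝ) + 1)) • o) ∈ slice := by
  have hy : ∀ n : ℕ, x + (1 / ((n : ℝ) + 1)) • o ∈ cone := fun n => by
    rw [add_comm]
    exact add_mem_cone_of_mem_closure (smul_mem_cone ho (by positivity)) hx
  choose g hg hgp using fun n => exists_act_mem_prism (hy n)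
  have hpos := fun n => hgt_pos (act_mem_cone (hg n) (hy n))
  refine ⟨g, fun n => (hgt ⬝ᵥ act (g n) (x + (1 / ((n : ℝ) + 1)) • o))⁻¹, fun n =>
    ⟨hg n, inv_pos.2 (hpos n), smul_mem_prism (hgp n) (inv_pos.2 (hpos n)).le, ?_⟩⟩
  rw [dotProduct_smul, smul_eq_mul, inv_mul_cancel₀ (hpos n).ne']

lemma tendsto_one_div : Filter.Tendsto (fun n : ℕ => 1 / ((n : ℝ) + 1))
    (Filter.hyperfilter ℕ : Filter ℕ) (nhds 0) :=
  tendsto_one_div_add_atTop_nhds_zero_nat.mono_left Nat.hyperfilter_le_atTop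

lemma exists_comparison {y : Vec 3} (hy : y ∈ cone) :
    ∃ A : ℝ, 0 < A ∧ ∀ z ∈ slice, A • z - y ∈ cone ∧ A • y - z ∈ cone := by
  obtain ⟨δ, hδ, hsub⟩ := isCompact_slice.exists_cthickening_subset_open isOpen_cone
    slice_subset_cone
  obtain ⟨ε, hε, hball⟩ := Metric.isOpen_iff.1 isOpen_cone y hy
  obtain ⟨M, hM⟩ := isCompact_slice.isBounded.exists_norm_le
  obtain ⟨t, ht, h1, h2⟩ : ∃ t : ℝ, 0 < t ∧ t * ‖y‖ ≤ δ ∧ t * |M| < ε := by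
    refine ⟨min (δ / (‖y‖ + 1)) (ε / (|M| + 1)), by positivity, ?_, ?_⟩
    · calc _ ≤ δ / (‖y‖ + 1) * ‖y‖ := by gcongr; exact min_le_left _ _
        _ ≤ δ / (‖y‖ + 1) * (‖y‖ + 1) := by gcongr; linarith
        _ = δ := by field_simp
    · calc _ ≤ ε / (|M| + 1) * |M| := by gcongr; exact min_le_right _ _
        _ < ε / (|M| + 1) * (|M| + 1) := by gcongr; linarith
        _ = ε := by field_simp
  refine ⟨t⁻¹, inv_pos.2 ht, fun z hz => ⟨?_, ?_⟩⟩
  · rw [← smul_mem_cone_iff ht, smul_sub, smul_inv_smul₀ ht.ne']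
    refine hsub (Metric.mem_cthickening_of_dist_le _ _ _ _ hz ?_)
    rw [dist_eq_norm, sub_sub_cancel_left, norm_neg, norm_smul, Real.norm_eq_abs, abs_of_pos ht]
    exact h1
  · rw [← smul_mem_cone_iff ht, smul_sub, smul_inv_smul₀ ht.ne']
    apply hball
    rw [mem_ball_iff_norm, sub_sub_cancel_left, norm_neg, norm_smul, Real.norm_eq_abs,
      abs_of_pos ht]
    refine lt_of_le_of_lt ?_ h2
    gcongr
    exact (hM z hz).trans (le_abs_self M)

lemma exists_functional_bound : ∃ B : ℝ, ∀ ψ : Vec 3 →ₗ[ℝ] ℝ, (∀ x ∈ cone, 0 ≤ ψ x) →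
    ∀ z ∈ slice, ψ z = 1 → ∀ k, |ψ (Pi.single k 1)| ≤ B := by
  obtain ⟨δ, hδ, hsub⟩ := isCompact_slice.exists_cthickening_subset_open isOpen_cone
    slice_subset_cone
  refine ⟨1 / δ, fun ψ hψ z hz h1 k => ?_⟩
  have hmem : ∀ s : ℝ, |s| = δ → 0 ≤ ψ z + s * ψ (Pi.single k 1) := by
    intro s hs
    rw [← smul_eq_mul, ← map_smul, ← map_add]
    refine hψ _ (hsub (Metric.mem_cthickening_of_dist_le _ _ _ _ hz ?_))
    rw [dist_eq_norm, add_sub_cancel_left, norm_smul, Pi.norm_single]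
    simp [hs]
  have a := hmem δ (abs_of_pos hδ)
  have b := hmem (-δ) (by rw [abs_neg, abs_of_pos hδ])
  rw [h1] at a b
  have h2 : |ψ (Pi.single k 1) * δ| ≤ 1 := abs_le.2 ⟨by linarith, by linarith⟩
  rwa [abs_mul, abs_of_pos hδ, ← le_div_iff₀ hδ] at h2

/-! ### There is no two-dimensional face in the boundary -/

lemma eq_zero_of_apply_ver {φ : Vec 3 →ₗ[ℝ] ℝ} (hφ : ∀ x ∈ cone, 0 ≤ φ x)
    (h : ∀ i, φ (ver i) = 0) : φ = 0 := by
  have h3 := apply_single_three_eq_zero hφ (h 0)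
  refine LinearMap.ext fun x => ?_
  have : x = x 0 • ver 0 + x 1 • ver 1 + x 2 • ver 2 + x 3 • Pi.single 3 1 := by
    ext k
    fin_cases k <;> simp [ver_eq]
  rw [this]
  simp [h, h3]

lemma ver_apply_of_ne {i j : Fin 3} (h : i ≠ j) : ver i j.castSucc = 0 := by
  rw [ver, Pi.single_eq_of_ne]
  exact fun hc => h (Fin.castSucc_injective _ hc).symm

lemma eq_smul_ver {x : Vec 3} (hx : x ∈ closure cone) {i : Fin 3}
    (h : ∀ j, i ≠ j → x j.castSucc = 0) : x = x i.castSucc • ver i := by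
  obtain ⟨j, hij⟩ : ∃ j, i ≠ j := ⟨i + 1, by fin_cases i <;> decide⟩
  have h3 : x 3 = 0 := apply_three_eq_zero hx (h j hij)
  ext k
  induction k using Fin.lastCases with
  | last =>
    change x 3 = x i.castSucc * ver i 3
    rw [h3, ver_apply_three, mul_zero]
  | cast k =>
    by_cases hk : i = k
    · rw [← hk, Pi.smul_apply, ver_apply_self, smul_eq_mul, mul_one]
    · rw [h k hk, Pi.smul_apply, ver_apply_of_ne hk, smul_zero]

lemma no_cone_point {φ : Vec 3 →ₗ[ℝ] ℝ} {o : Vec 3} (hφ : ∀ x ∈ cone, 0 ≤ φ x)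
    (ho : o ∈ closure cone) (h1 : φ o = 1)
    (h : ∀ y ∈ closure cone, y - φ y • o ∈ closure cone) : False := by
  have hz : ∀ i j : Fin 3, i ≠ j → 0 < φ (ver i) → o j.castSucc = 0 := by
    intro i j hij hi
    have h2 := apply_nonneg (h _ (ver_mem_closure i)) j
    have h3 := apply_nonneg ho j
    rw [Pi.sub_apply, Pi.smul_apply, ver_apply_of_ne hij, smul_eq_mul, zero_sub, Left.nonneg_neg_iff] at h2
    have := nonpos_of_mul_nonpos_right h2 hi
    linarith
  have hex : ∃ i, 0 < φ (ver i) := by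
    by_contra hcon
    push Not at hcon
    have := eq_zero_of_apply_ver hφ fun i =>
      le_antisymm (hcon i) (nonneg_of_mem_closure hφ (ver_mem_closure i))
    simp [this] at h1
  obtain ⟨i, hi⟩ := hex
  obtain ⟨j, hij⟩ : ∃ j, i ≠ j := ⟨i + 1, by fin_cases i <;> decide⟩
  have o3 : o 3 = 0 := apply_three_eq_zero ho (hz i j hij hi)
  have oi := eq_smul_ver ho fun k hk => hz i k hk hi
  have hoi : o i.castSucc * φ (ver i) = 1 := by
    rw [oi, map_smul] at h1
    exact h1
  have h0 : ∀ k, i ≠ k → φ (ver k) = 0 := by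
    intro k hk
    refine le_antisymm ?_ (nonneg_of_mem_closure hφ (ver_mem_closure k))
    by_contra hcon
    push Not at hcon
    rw [hz k i hk.symm hcon, zero_mul] at hoi
    exact zero_ne_one hoi
  have h3 := apply_single_three_eq_zero hφ (h0 j hij)
  have hy := prism_vertices_mem_cone.2.2.2.1
  set y : Vec 3 := ![1, 1, 1, 3] with hyd
  have hφy : φ y = φ (ver i) := by
    have : y = ver 0 + ver 1 + ver 2 + (3 : ℝ) • Pi.single 3 1 := by
      ext k
      fin_cases k <;> simp [ver_eq, hyd]
    rw [this]
    simp only [map_add, map_smul, h3, smul_zero, add_zero]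
    fin_cases i <;> simp [h0]
  have hyi : y i.castSucc = 1 := by fin_cases i <;> simp [hyd]
  have h4 := apply_three_eq_zero (h y (subset_closure hy)) (i := i) (by
    rw [Pi.sub_apply, Pi.smul_apply, hφy, hyi, smul_eq_mul, mul_comm, hoi, sub_self])
  rw [Pi.sub_apply, Pi.smul_apply, o3, smul_zero, sub_zero] at h4
  simp [hyd] at h4

/-- In the relative interior of a two-dimensional face, small perturbations within the supporting
hyperplane stay in the closed cone. -/
lemma eventually_add_mem_closure {φ : Vec 3 →ₗ[ℝ] ℝ} {p q r o : Vec 3}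
    (hp : p ∈ closure cone) (hq : q ∈ closure cone) (hr : r ∈ closure cone)
    (ep : φ p = 0) (eq : φ q = 0) (er : φ r = 0) (eo : φ o ≠ 0)
    (hli : LinearIndependent ℝ ![p, q, r]) {F : Filter ℕ} {s : ℕ → Vec 3}
    (hs : Filter.Tendsto s F (nhds 0)) (h0 : ∀ n, φ (s n) = 0) {t : ℝ} (ht : 0 < t) :
    ∀ᶠ n in F, s n + t • (p + q + r) ∈ closure cone := by
  have hli4 : LinearIndependent ℝ (Fin.cons o ![p, q, r] : Fin 4 → Vec 3) := by
    refine LinearIndependent.finCons hli fun hc => eo ?_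
    have : Submodule.span ℝ (Set.range ![p, q, r]) ≤ LinearMap.ker φ := by
      rw [Submodule.span_le]
      rintro _ ⟨i, rfl⟩
      fin_cases i <;> simpa
    exact this hc
  let b := basisOfLinearIndependentOfCardEqFinrank hli4 (by simp)
  have hb : ⇑b = Fin.cons o ![p, q, r] := coe_basisOfLinearIndependentOfCardEqFinrank _ _
  have hsum : ∀ v, v = b.coord 0 v • o + b.coord 1 v • p + b.coord 2 v • q + b.coord 3 v • r := by
    intro v
    conv_lhs => rw [← b.sum_repr v]
    rw [Fin.sum_univ_four, hb]
    rfl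
  have hc : ∀ i, ∀ᶠ n in F, -t < b.coord i (s n) := by
    intro i
    have h1 : Filter.Tendsto (fun n => b.coord i (s n)) F (nhds (b.coord i 0)) :=
      ((b.coord i).continuous_of_finiteDimensional.tendsto 0).comp hs
    rw [map_zero] at h1
    exact h1.eventually_const_lt (by linarith)
  filter_upwards [hc 1, hc 2, hc 3] with n h1 h2 h3
  have hc0 : b.coord 0 (s n) = 0 := by
    have := h0 n
    rw [hsum (s n)] at this
    simpa [ep, eq, er, eo] using this
  have e : s n + t • (p + q + r) = (b.coord 1 (s n) + t) • p + (b.coord 2 (s n) + t) • q +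
      (b.coord 3 (s n) + t) • r := by
    conv_lhs => rw [hsum (s n), hc0]
    module
  rw [e]
  exact add_mem_closure (add_mem_closure (smul_mem_closure hp (by linarith))
    (smul_mem_closure hq (by linarith))) (smul_mem_closure hr (by linarith))

lemma no_face {φ : Vec 3 →ₗ[ℝ] ℝ} (hφ : ∀ x ∈ cone, 0 ≤ φ x) (h0 : φ ≠ 0) {p q r : Vec 3}
    (hp : p ∈ closure cone) (hq : q ∈ closure cone) (hr : r ∈ closure cone)
    (ep : φ p = 0) (eq : φ q = 0) (er : φ r = 0) (hli : LinearIndependent ℝ ![p, q, r]) :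
    False := by
  have ho := basePt_mem_cone
  set o := basePt
  have hφo := pos_of_mem_cone hφ h0 ho
  have hxc : p + q + r ∈ closure cone := add_mem_closure (add_mem_closure hp hq) hr
  have ex : φ (p + q + r) = 0 := by simp [ep, eq, er]
  obtain ⟨g, l, hgl⟩ := exists_zoom hxc ho
  have hg := fun n => (hgl n).1
  have hl := fun n => (hgl n).2.1
  have hz := fun n => (hgl n).2.2
  set x := p + q + r with hx
  set d : ℕ → ℝ := fun n => 1 / ((n : ℝ) + 1) with hd
  have hdpos : ∀ n, 0 < d n := fun n => by positivity
  have hyx : Filter.Tendsto (fun n => x + d n • o) (Filter.hyperfilter ℕ : Filter ℕ) (nhds x) := by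
    have := (tendsto_const_nhds (x := x)).add (tendsto_one_div.smul_const o)
    rwa [zero_smul, add_zero] at this
  obtain ⟨o', ho', hlo⟩ := exists_lim (isCompact_cap 1) (v := fun n => l n • act (g n) (d n • o))
    (fun n => mem_cap_of_add_mem_slice
      (smul_mem_closure (act_mem_closure (hg n) (smul_mem_closure (subset_closure ho)
        (hdpos n).le)) (hl n).le)
      (smul_mem_closure (act_mem_closure (hg n) hxc) (hl n).le) (by
        have := hz n
        rwa [map_add, smul_add, add_comm] at this))
  let T : ℕ → Vec 3 →ₗ[ℝ] Vec 3 := fun n => (l n)⁻¹ • act (g n)⁻¹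
  have hT : ∀ n v, T n (l n • act (g n) v) = v := fun n v => by
    simp only [T, LinearMap.smul_apply, map_smul]
    rw [act_inv_act, smul_inv_smul₀ (hl n).ne']
  have hT' : ∀ n v, l n • act (g n) (T n v) = v := fun n v => by
    simp only [T, LinearMap.smul_apply, map_smul, act_act_inv]
    rw [smul_inv_smul₀ (hl n).ne']
  have hTc : ∀ n, ∀ v ∈ cone, T n v ∈ cone := fun n v hv =>
    smul_mem_cone (act_mem_cone (inv_mem (hg n)) hv) (inv_pos.2 (hl n))
  let ψ : ℕ → Vec 3 →ₗ[ℝ] ℝ := fun n => (d n * φ o)⁻¹ • φ.comp (T n)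
  have hψ : ∀ n v, ψ n v = (d n * φ o)⁻¹ * φ (T n v) := fun n v => rfl
  have hψ0 : ∀ n, ∀ v ∈ cone, 0 ≤ ψ n v := fun n v hv =>
    mul_nonneg (inv_nonneg.2 (mul_nonneg (hdpos n).le hφo.le)) (hφ _ (hTc n v hv))
  have hψz : ∀ n, ψ n (l n • act (g n) (x + d n • o)) = 1 := fun n => by
    rw [hψ, hT, map_add, ex, map_smul, zero_add, smul_eq_mul, inv_mul_cancel₀]
    exact (mul_pos (hdpos n) hφo).ne'
  obtain ⟨B, hB⟩ := exists_functional_bound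
  obtain ⟨ψ', hψ'⟩ := exists_lim_functional (fun n k => hB (ψ n) (hψ0 n) _ (hz n) (hψz n) k)
  have hψ'0 : ∀ v ∈ cone, 0 ≤ ψ' v := fun v hv =>
    ge_of_tendsto (hψ' v) (Filter.Eventually.of_forall fun n => hψ0 n v hv)
  have hψo : ψ' o' = 1 := by
    have h1 := tendsto_functional_apply hψ' hlo
    refine tendsto_nhds_unique h1 (tendsto_const_nhds.congr fun n => ?_)
    rw [hψ, hT, map_smul, smul_eq_mul, inv_mul_cancel₀ (mul_pos (hdpos n) hφo).ne']
  have key : ∀ y ∈ cone, y - ψ' y • o' ∈ closure cone := by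
    intro y hy
    obtain ⟨A, hA, hAz⟩ := exists_comparison hy
    have c1 : ∀ n, A • (x + d n • o) - T n y ∈ cone := fun n => by
      have := hTc n _ (hAz _ (hz n)).1
      rwa [map_sub, map_smul, hT] at this
    have c2 : ∀ n, A • T n y - (x + d n • o) ∈ cone := fun n => by
      have := hTc n _ (hAz _ (hz n)).2
      rwa [map_sub, map_smul, hT] at this
    obtain ⟨w, hw, hlw⟩ := exists_lim (isCompact_cap (A * (hgt ⬝ᵥ x + hgt ⬝ᵥ o)))
      (v := fun n => T n y) (fun n => ⟨subset_closure (hTc n y hy), by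
        have h1 := (hgt_pos (c1 n)).le
        have h2 : d n ≤ 1 := by
          rw [hd, div_le_one (by positivity)]
          linarith [n.cast_nonneg (α := ℝ)]
        have h3 := mul_le_mul_of_nonneg_right h2 (hgt_pos ho).le
        have h4 := mul_le_mul_of_nonneg_left h3 hA.le
        simp only [dotProduct_sub, dotProduct_add, dotProduct_smul, smul_eq_mul] at h1
        linarith⟩)
    have w1 : A • x - w ∈ closure cone := isClosed_closure.mem_of_tendsto
      ((hyx.const_smul A).sub hlw) (Filter.Eventually.of_forall fun n => subset_closure (c1 n))
    have w2 : A • w - x ∈ closure cone := isClosed_closure.mem_of_tendsto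
      ((hlw.const_smul A).sub hyx) (Filter.Eventually.of_forall fun n => subset_closure (c2 n))
    have hφw : φ w = 0 := by
      have h1 := nonneg_of_mem_closure hφ w1
      have h2 := nonneg_of_mem_closure hφ hw.1
      rw [map_sub, map_smul, ex, smul_zero] at h1
      linarith
    have w3 : w - A⁻¹ • x ∈ closure cone := by
      have := smul_mem_closure w2 (inv_pos.2 hA).le
      rwa [smul_sub, inv_smul_smul₀ hA.ne'] at this
    have hs : Filter.Tendsto (fun n => T n y - (φ (T n y) / φ o) • o - w)
        (Filter.hyperfilter ℕ : Filter ℕ) (nhds 0) := by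
      have h1 := (φ.continuous_of_finiteDimensional.tendsto w).comp hlw
      have h2 := (hlw.sub ((h1.div_const (φ o)).smul_const o)).sub_const w
      rwa [hφw, zero_div, zero_smul, sub_zero, sub_self] at h2
    have hev := eventually_add_mem_closure hp hq hr ep eq er hφo.ne' hli hs (fun n => by
      rw [map_sub, map_sub, map_smul, hφw, smul_eq_mul, div_mul_cancel₀ _ hφo.ne', sub_self,
        sub_zero]) (inv_pos.2 hA)
    refine isClosed_closure.mem_of_tendsto (tendsto_const_nhds.sub ((hψ' y).smul hlo)) ?_
    filter_upwards [hev] with n hn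
    have h1 := smul_mem_closure (act_mem_closure (hg n) (add_mem_closure hn w3)) (hl n).le
    convert h1 using 1
    have e : T n y - (φ (T n y) / φ o) • o - w + A⁻¹ • (p + q + r) + (w - A⁻¹ • x) =
        T n y - (φ (T n y) / φ o) • o := by
      rw [hx]
      abel
    rw [e, map_sub, smul_sub, hT', hψ, map_smul, map_smul, smul_comm (l n) (d n), smul_smul,
      smul_comm (l n) (φ (T n y) / φ o)]
    congr 2
    have := (hdpos n).ne'
    field_simp
  refine no_cone_point hψ'0 ho'.1 hψo fun y hy => ?_
  have hcl : IsClosed {y | y - ψ' y • o' ∈ closure cone} :=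
    isClosed_closure.preimage (continuous_id.sub
      (ψ'.continuous_of_finiteDimensional.smul continuous_const))
  exact closure_minimal key hcl hy

/-! ### Triangles through the prism -/

lemma exists_eq_of_face {φ : Vec 3 →ₗ[ℝ] ℝ} (hφ : ∀ x ∈ cone, 0 ≤ φ x) (h0 : φ ≠ 0)
    {p q r : Vec 3} (hp : p ∈ closure cone) (hq : q ∈ closure cone) (hr : r ∈ closure cone)
    (ep : φ p = 0) (eq : φ q = 0) (er : φ r = 0) (hli : LinearIndependent ℝ ![p, q]) :
    ∃ a b : ℝ, r = a • p + b • q := by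
  by_contra hcon
  refine no_face hφ h0 hr hp hq er ep eq (LinearIndependent.finCons hli fun hm => hcon ?_)
  rw [Matrix.range_cons, Matrix.range_cons, Matrix.range_empty, Set.union_empty,
    Set.singleton_union, Submodule.mem_span_pair] at hm
  obtain ⟨a, b, h⟩ := hm
  exact ⟨a, b, h.symm⟩

lemma exists_ver_eq_of_reflections {i : Fin 3 → Fin 5} (hi : ∀ a b, a ≠ b → i a ≠ i b)
    (hc : ∀ a b, a ≠ b → cartan (i a) (i b) ≠ 0) {W : Submodule ℝ (Vec 3)}
    (hW : ∀ a, pole (i a) ∈ W) (j : Fin 3) : ver j ∈ W := by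
  have hadj : ∀ m n : Fin 5, m ≠ n → cartan m n ≠ 0 →
      (m < 3 ∧ n < 3) ∨ (m = 2 ∧ n = 3) ∨ (m = 3 ∧ n = 2) ∨ (m = 3 ∧ n = 4) ∨ (m = 4 ∧ n = 3) := by
    intro m n hmn h
    rw [cartan_eq] at h
    fin_cases m <;> fin_cases n <;> simp at hmn h ⊢
  have comb : ∀ a b c : Fin 5, a ≠ b → b ≠ c → a ≠ c →
      ((a < 3 ∧ b < 3) ∨ (a = 2 ∧ b = 3) ∨ (a = 3 ∧ b = 2) ∨ (a = 3 ∧ b = 4) ∨ (a = 4 ∧ b = 3)) →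
      ((b < 3 ∧ c < 3) ∨ (b = 2 ∧ c = 3) ∨ (b = 3 ∧ c = 2) ∨ (b = 3 ∧ c = 4) ∨ (b = 4 ∧ c = 3)) →
      ((a < 3 ∧ c < 3) ∨ (a = 2 ∧ c = 3) ∨ (a = 3 ∧ c = 2) ∨ (a = 3 ∧ c = 4) ∨ (a = 4 ∧ c = 3)) →
      ∀ m : Fin 5, m < 3 → m = a ∨ m = b ∨ m = c := by decide
  have d01 : (0 : Fin 3) ≠ 1 := by decide
  have d12 : (1 : Fin 3) ≠ 2 := by decide
  have d02 : (0 : Fin 3) ≠ 2 := by decide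
  have hp : ∀ m : Fin 5, m < 3 → pole m ∈ W := by
    intro m hm
    rcases comb (i 0) (i 1) (i 2) (hi _ _ d01) (hi _ _ d12) (hi _ _ d02)
      (hadj _ _ (hi _ _ d01) (hc _ _ d01)) (hadj _ _ (hi _ _ d12) (hc _ _ d12))
      (hadj _ _ (hi _ _ d02) (hc _ _ d02)) m hm with rfl | rfl | rfl
    exacts [hW 0, hW 1, hW 2]
  have p0 := hp 0 (by decide)
  have p1 := hp 1 (by decide)
  have p2 := hp 2 (by decide)
  have v2 : ver 2 = (-2 : ℝ) • (pole 0 + pole 1 + pole 2) := by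
    ext k
    fin_cases k <;> simp [ver_eq, pole] <;> norm_num
  have v1 : ver 1 = pole 1 + ver 2 := by
    ext k
    fin_cases k <;> simp [ver_eq, pole]
  have v0 : ver 0 = pole 0 + ver 1 := by
    ext k
    fin_cases k <;> simp [ver_eq, pole]
  have m2 : ver 2 ∈ W := by
    rw [v2]
    exact W.smul_mem _ (W.add_mem (W.add_mem p0 p1) p2)
  have m1 : ver 1 ∈ W := by
    rw [v1]
    exact W.add_mem p1 m2
  fin_cases j
  · rw [Fin.zero_eta, v0]
    exact W.add_mem p0 m1
  · exact m1
  · exact m2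

lemma pole_eq_of_apply_neg {e : Fin 3 → Vec 3} {φ : Fin 3 → Vec 3 →ₗ[ℝ] ℝ}
    (he : ∀ l, e l ∈ closure cone) (hφ : ∀ l, ∀ x ∈ cone, 0 ≤ φ l x)
    (h1 : ∀ l, φ l (e l) = 1) (h0 : ∀ l m, l ≠ m → φ l (e m) = 0)
    (hz : ∑ l, e l ∈ prism) {i : Fin 5} {k : Fin 3} (hk : form i ⬝ᵥ e k < 0) :
    ∃ j, j ≠ k ∧ 0 < form i ⬝ᵥ e j ∧ (∀ l, l ≠ j → l ≠ k → form i ⬝ᵥ e l = 0) ∧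
      pole i = (form i ⬝ᵥ e j)⁻¹ • e j + (form i ⬝ᵥ e k)⁻¹ • e k := by
  have hφ0 : ∀ l, φ l ≠ 0 := fun l hc => by
    have := h1 l
    simp [hc] at this
  obtain ⟨j, hj⟩ : ∃ j, 0 < form i ⬝ᵥ e j := by
    by_contra hcon
    push Not at hcon
    have h2 := hz i
    rw [dotProduct_sum] at h2
    have h3 : ∑ l, form i ⬝ᵥ e l < 0 := Finset.sum_neg' (fun l _ => hcon l) ⟨k, by simp, hk⟩
    linarith
  have hjk : j ≠ k := by
    rintro rfl
    exact lt_asymm hj hk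
  obtain ⟨l, hlj, hlk, hl⟩ : ∃ l, l ≠ j ∧ l ≠ k ∧ ∀ m, m ≠ j → m ≠ k → m = l := by
    have : ∀ j k : Fin 3, j ≠ k → ∃ l, l ≠ j ∧ l ≠ k ∧ ∀ m, m ≠ j → m ≠ k → m = l := by decide
    exact this j k hjk
  set A := form i ⬝ᵥ e j with hA
  set B := form i ⬝ᵥ e k with hB
  have hs : ∀ (m n : Fin 3), 0 ≤ φ m (e n) - (form i ⬝ᵥ e n) * φ m (pole i) := by
    intro m n
    have := nonneg_of_mem_closure (hφ m) (act_mem_closure (refl_mem i) (he n))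
    rwa [act_refl, map_sub, map_smul, smul_eq_mul] at this
  have hlb : φ l (pole i) = 0 := by
    have a := hs l j
    have b := hs l k
    rw [h0 l j hlj, ← hA] at a
    rw [h0 l k hlk, ← hB] at b
    apply le_antisymm
    · nlinarith
    · nlinarith
  have hli : LinearIndependent ℝ ![e j, e k] := by
    rw [LinearIndependent.pair_iff]
    intro s t hst
    have a := congrArg (φ j) hst
    have b := congrArg (φ k) hst
    rw [map_add, map_smul, map_smul, map_zero, h1, h0 j k hjk] at a
    rw [map_add, map_smul, map_smul, map_zero, h1, h0 k j hjk.symm] at b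
    simp at a b
    exact ⟨a, b⟩
  obtain ⟨x, y, hxy⟩ := exists_eq_of_face (hφ l) (hφ0 l) (he j) (he k)
    (act_mem_closure (refl_mem i) (he j)) (h0 l j hlj) (h0 l k hlk)
    (by rw [act_refl, map_sub, map_smul, hlb, h0 l j hlj, smul_zero, sub_zero]) hli
  rw [act_refl, ← hA] at hxy
  have hb : pole i = (φ j (pole i)) • e j + (φ k (pole i)) • e k := by
    have e1 : pole i = (A⁻¹ * (1 - x)) • e j + (A⁻¹ * (-y)) • e k := by
      have : A • pole i = (1 - x) • e j + (-y) • e k := by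
        have h2 : A • pole i = e j - (x • e j + y • e k) := by rw [← hxy, sub_sub_cancel]
        rw [h2]
        module
      rw [← smul_smul, ← smul_smul, ← smul_add, ← this, inv_smul_smul₀ hj.ne']
    have e2 : φ j (pole i) = A⁻¹ * (1 - x) := by
      rw [e1, map_add, map_smul, map_smul, h1, h0 j k hjk]
      simp
    have e3 : φ k (pole i) = A⁻¹ * (-y) := by
      rw [e1, map_add, map_smul, map_smul, h1, h0 k j hjk.symm]
      simp
    rw [e2, e3]
    exact e1
  have hα : A * φ j (pole i) + B * φ k (pole i) = 2 := by
    have h2 := cartan_self i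
    rw [cartan, hb, dotProduct_add, dotProduct_smul, dotProduct_smul, ← hA, ← hB] at h2
    simp only [smul_eq_mul] at h2
    linarith
  have a1 := hs j j
  have a2 := hs k k
  have a3 := hs j k
  have a4 := hs k j
  rw [h1, ← hA] at a1
  rw [h1, ← hB] at a2
  have ej : A * φ j (pole i) = 1 := by linarith
  have ek : B * φ k (pole i) = 1 := by linarith
  have ej' : φ j (pole i) = A⁻¹ := eq_inv_of_mul_eq_one_right ej
  have ek' : φ k (pole i) = B⁻¹ := eq_inv_of_mul_eq_one_right ek
  refine ⟨j, hjk, hj, fun m hmj hmk => ?_, ?_⟩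
  · have b1 := hs j m
    have b2 := hs k m
    rw [h0 j m hmj.symm, ej'] at b1
    rw [h0 k m hmk.symm, ek'] at b2
    have p1 := inv_pos.2 hj
    have p2 := inv_lt_zero.2 hk
    apply le_antisymm
    · nlinarith
    · nlinarith
  · rw [hb, ej', ek']

/-- The vertices of a triangle meeting the prism whose sides lie in the boundary are those of the
invariant triangle. -/
lemma exists_eq_smul_ver {e : Fin 3 → Vec 3} {φ : Fin 3 → Vec 3 →ₗ[ℝ] ℝ}
    (he : ∀ l, e l ∈ closure cone) (hφ : ∀ l, ∀ x ∈ cone, 0 ≤ φ l x)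
    (h1 : ∀ l, φ l (e l) = 1) (h0 : ∀ l m, l ≠ m → φ l (e m) = 0)
    (hz : ∑ l, e l ∈ prism) (l : Fin 3) : ∃ i, ∃ c : ℝ, 0 < c ∧ e l = c • ver i := by
  have hφ0 : ∀ l, φ l ≠ 0 := fun l hc => by
    have := h1 l
    simp [hc] at this
  have hex : ∀ k, ∃ i, form i ⬝ᵥ e k < 0 := by
    intro k
    by_contra hcon
    push Not at hcon
    obtain ⟨j, hjk⟩ : ∃ j, j ≠ k := ⟨k + 1, by fin_cases k <;> decide⟩
    have hne : e k ≠ 0 := by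
      intro hc
      have := h1 k
      simp [hc] at this
    have := pos_of_mem_cone (hφ j) (hφ0 j) (mem_cone_of_mem_prism hcon hne)
    rw [h0 j k hjk] at this
    exact lt_irrefl _ this
  choose i hi using hex
  choose p hp hpos hpz hpole using fun k => pole_eq_of_apply_neg he hφ h1 h0 hz (hi k)
  have hinj : ∀ a b, a ≠ b → 0 ≤ form (i a) ⬝ᵥ e b := by
    intro a b hab
    by_cases hb : b = p a
    · rw [hb]
      exact (hpos a).le
    · exact (hpz a b hb hab.symm).ge
  have hver : ∀ j, ver j ∈ Submodule.span ℝ (Set.range e) := by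
    refine exists_ver_eq_of_reflections (i := i) ?_ ?_ ?_
    · intro a b hab hc
      have h2 := hinj a b hab
      rw [hc] at h2
      exact absurd (hi b) (not_lt.2 h2)
    · intro a b hab
      have hb := inv_lt_zero.2 (hi b)
      have hpb := inv_pos.2 (hpos b)
      rw [cartan, hpole b, dotProduct_add, dotProduct_smul, dotProduct_smul, smul_eq_mul,
        smul_eq_mul]
      have hab' := hinj a b hab
      by_cases hpa : p b = a
      · have h2 := hi a
        rw [hpa] at hpb ⊢
        nlinarith
      · by_cases hba : p a = b
        · have h2 : form (i a) ⬝ᵥ e (p b) = 0 := by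
            refine hpz a _ ?_ hpa
            rw [hba]
            exact hp b
          have h3 := hpos a
          rw [hba] at h3
          rw [h2]
          nlinarith
        · have h2 : form (i a) ⬝ᵥ e b = 0 := hpz a b (Ne.symm hba) hab.symm
          have h3 : p b = p a := by
            have : ∀ a b x y : Fin 3, a ≠ b → x ≠ a → x ≠ b → y ≠ a → y ≠ b → y = x := by decide
            exact this a b (p a) (p b) hab (hp a) hba hpa (hp b)
          have h4 := hpos a
          rw [h2, h3]
          rw [h3] at hpb
          simp only [mul_zero, add_zero]
          positivity
    · intro a
      rw [hpole a]
      exact Submodule.add_mem _ (Submodule.smul_mem _ _ (Submodule.subset_span ⟨_, rfl⟩))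
        (Submodule.smul_mem _ _ (Submodule.subset_span ⟨_, rfl⟩))
  obtain ⟨j, hj⟩ : ∃ j, 0 < φ l (ver j) := by
    by_contra hcon
    push Not at hcon
    exact hφ0 l (eq_zero_of_apply_ver (hφ l) fun j =>
      le_antisymm (hcon j) (nonneg_of_mem_closure (hφ l) (ver_mem_closure j)))
  obtain ⟨c, hc⟩ := (Submodule.mem_span_range_iff_exists_fun ℝ).1 (hver j)
  have hcφ : ∀ m, φ m (ver j) = c m := by
    intro m
    rw [← hc, map_sum, Finset.sum_eq_single m]
    · simp [h1]
    · intro n _ hn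
      rw [map_smul, h0 m n hn.symm, smul_zero]
    · simp
  have hel : e l = e l j.castSucc • ver j := by
    refine eq_smul_ver (he l) fun k hk => ?_
    have h2 := congrFun hc k.castSucc
    rw [ver_apply_of_ne hk, Finset.sum_apply] at h2
    have h3 := (Finset.sum_eq_zero_iff_of_nonneg (fun m _ => ?_)).1 h2 l (Finset.mem_univ _)
    · rw [Pi.smul_apply, smul_eq_mul, ← hcφ] at h3
      exact (mul_eq_zero.1 h3).resolve_left hj.ne'
    · rw [Pi.smul_apply, smul_eq_mul, ← hcφ]
      exact mul_nonneg (nonneg_of_mem_closure (hφ m) (ver_mem_closure j)) (apply_nonneg (he m) k)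
  refine ⟨j, e l j.castSucc, ?_, hel⟩
  have h2 := h1 l
  rw [hel, map_smul, smul_eq_mul] at h2
  by_contra hcon
  push Not at hcon
  nlinarith

/-! ### Segments in the boundary -/

lemma exists_supporting {x : Vec 3} (hx : x ∉ cone) :
    ∃ φ : Vec 3 →ₗ[ℝ] ℝ, (∀ y ∈ cone, 0 ≤ φ y) ∧ φ ≠ 0 ∧ φ x ≤ 0 := by
  obtain ⟨f, hf⟩ := geometric_hahn_banach_point_open convex_cone isOpen_cone hx
  have hb := basePt_mem_cone
  have key : ∀ y ∈ cone, 0 ≤ f y := by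
    intro y hy
    by_contra hcon
    push Not at hcon
    have h1 := hf _ (smul_mem_cone hy (t := (|f x| + 1) / (-f y)) (div_pos (by positivity)
      (by linarith)))
    rw [map_smul, smul_eq_mul, div_mul_eq_mul_div, div_neg, mul_div_assoc, div_self hcon.ne] at h1
    linarith [neg_abs_le (f x)]
  refine ⟨f.toLinearMap, key, ?_, ?_⟩
  · intro h
    have h0 : ∀ y, f y = 0 := fun y => LinearMap.congr_fun h y
    have := hf _ hb
    rw [h0, h0] at this
    exact lt_irrefl _ this
  · change f x ≤ 0
    have h1 : Filter.Tendsto (fun t : ℝ => f (t • basePt)) (nhdsWithin 0 (Set.Ioi 0)) (nhds 0) := by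
      have : Filter.Tendsto (fun t : ℝ => f (t • basePt)) (nhds 0) (nhds (f ((0 : ℝ) • basePt))) :=
        Continuous.tendsto (by fun_prop) 0
      rw [zero_smul, map_zero] at this
      exact this.mono_left nhdsWithin_le_nhds
    refine ge_of_tendsto h1 ?_
    filter_upwards [self_mem_nhdsWithin] with t ht
    exact (hf _ (smul_mem_cone hb ht)).le

lemma exists_dual_of_add_notMem {a b c : Vec 3} (ha : a ∈ closure cone) (hb : b ∈ closure cone)
    (hab : a + b ∉ cone) (h : a + b + c ∈ cone) :
    ∃ φ : Vec 3 →ₗ[ℝ] ℝ, (∀ y ∈ cone, 0 ≤ φ y) ∧ φ c = 1 ∧ φ a = 0 ∧ φ b = 0 := by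
  obtain ⟨φ, hφ, h0, h1⟩ := exists_supporting hab
  have h2 := pos_of_mem_cone hφ h0 h
  have a0 := nonneg_of_mem_closure hφ ha
  have b0 := nonneg_of_mem_closure hφ hb
  rw [map_add, map_add] at h2
  rw [map_add] at h1
  have hc : 0 < φ c := by linarith
  refine ⟨(φ c)⁻¹ • φ, fun y hy => mul_nonneg (inv_nonneg.2 hc.le) (hφ y hy), ?_, ?_, ?_⟩
  · simp [hc.ne']
  · simp [le_antisymm (by linarith : φ a ≤ 0) a0]
  · simp [le_antisymm (by linarith : φ b ≤ 0) b0]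

lemma exists_transposition {i j : Fin 3} (hij : i ≠ j) : ∃ g ∈ Gam, ∀ x : Vec 3,
    act g x = x - (x i.castSucc - x j.castSucc) • (ver i - ver j) := by
  have h := refl_mem
  have h01 : ∀ x, act (refl 0) x = ![x 1, x 0, x 2, x 3] := fun x => by
    conv_lhs => rw [vec_eta x]
    rw [act_refl_zero]
  have h12 : ∀ x, act (refl 1) x = ![x 0, x 2, x 1, x 3] := fun x => by
    conv_lhs => rw [vec_eta x]
    rw [act_refl_one]
  have h02 : ∀ x, act (refl 0 * refl 1 * refl 0) x = ![x 2, x 1, x 0, x 3] := fun x => by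
    rw [act_mul, act_mul, h01 x, act_refl_one, act_refl_zero]
  have m02 := mul_mem (mul_mem (h 0) (h 1)) (h 0)
  fin_cases i <;> fin_cases j
  · exact absurd rfl hij
  · refine ⟨_, h 0, fun x => ?_⟩
    rw [h01]
    ext k
    fin_cases k <;> simp [ver_eq]
  · refine ⟨_, m02, fun x => ?_⟩
    rw [h02]
    ext k
    fin_cases k <;> simp [ver_eq]
  · refine ⟨_, h 0, fun x => ?_⟩
    rw [h01]
    ext k
    fin_cases k <;> simp [ver_eq]
  · exact absurd rfl hij
  · refine ⟨_, h 1, fun x => ?_⟩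
    rw [h12]
    ext k
    fin_cases k <;> simp [ver_eq]
  · refine ⟨_, m02, fun x => ?_⟩
    rw [h02]
    ext k
    fin_cases k <;> simp [ver_eq]
  · refine ⟨_, h 1, fun x => ?_⟩
    rw [h12]
    ext k
    fin_cases k <;> simp [ver_eq]
  · exact absurd rfl hij

lemma exists_perm (σ : Equiv.Perm (Fin 3)) : ∃ g ∈ Gam, ∀ x : Vec 3,
    (∀ k, act g x (σ k).castSucc = x k.castSucc) ∧ act g x 3 = x 3 := by
  induction σ using Equiv.Perm.swap_induction_on with
  | one => exact ⟨1, one_mem _, fun x => by simp [act_one]⟩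
  | swap_mul τ i j hij ih =>
    obtain ⟨g, hg, hgx⟩ := ih
    obtain ⟨r, hr, hrx⟩ := exists_transposition hij
    refine ⟨r * g, mul_mem hr hg, fun x => ⟨fun k => ?_, ?_⟩⟩
    · rw [← (hgx x).1 k, act_mul, hrx, Equiv.Perm.mul_apply]
      generalize act g x = y
      generalize τ k = m
      rw [Pi.sub_apply, Pi.smul_apply, Pi.sub_apply, smul_eq_mul]
      rcases eq_or_ne m i with rfl | hmi
      · rw [Equiv.swap_apply_left, ver_apply_of_ne hij, ver_apply_self]
        ring
      · rcases eq_or_ne m j with rfl | hmj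
        · rw [Equiv.swap_apply_right, ver_apply_of_ne hij.symm, ver_apply_self]
          ring
        · rw [Equiv.swap_apply_of_ne_of_ne hmi hmj, ver_apply_of_ne hmi.symm,
            ver_apply_of_ne hmj.symm]
          ring
    · rw [act_mul, hrx, Pi.sub_apply, Pi.smul_apply, Pi.sub_apply, ver_apply_three,
        ver_apply_three, (hgx x).2]
      simp

lemma exists_homology {i j : Fin 3} (hij : i ≠ j) : ∃ g ∈ Gam, ∀ x : Vec 3,
    act g x = x - (2 * x j.castSucc - x i.castSucc) • ((1 / 2 : ℝ) • ver j - ver i) := by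
  obtain ⟨σ, rfl, rfl⟩ : ∃ σ : Equiv.Perm (Fin 3), σ 0 = i ∧ σ 2 = j := by
    have : ∀ i j : Fin 3, i ≠ j → ∃ σ : Equiv.Perm (Fin 3), σ 0 = i ∧ σ 2 = j := by decide
    exact this i j hij
  obtain ⟨g, hg, hgx⟩ := exists_perm σ
  refine ⟨g * refl 2 * g⁻¹, mul_mem (mul_mem hg (refl_mem 2)) (inv_mem hg), fun x => ?_⟩
  have hpole : act g (pole 2) = (1 / 2 : ℝ) • ver (σ 2) - ver (σ 0) := by
    ext k
    induction k using Fin.lastCases with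
    | last =>
      change act g (pole 2) 3 = (1 / 2 : ℝ) * ver (σ 2) 3 - ver (σ 0) 3
      rw [(hgx _).2, ver_apply_three, ver_apply_three]
      simp [pole]
    | cast k =>
      obtain ⟨m, rfl⟩ := σ.surjective k
      rw [(hgx _).1, Pi.sub_apply, Pi.smul_apply, ver, ver]
      fin_cases m <;> simp [pole, Fin.castSucc_inj, σ.injective.eq_iff]
  have hform : form 2 ⬝ᵥ act g⁻¹ x = 2 * x (σ 2).castSucc - x (σ 0).castSucc := by
    have h0 := (hgx (act g⁻¹ x)).1 0
    have h2 := (hgx (act g⁻¹ x)).1 2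
    rw [act_act_inv] at h0 h2
    rw [h0, h2, dot_eq]
    simp [form]
    ring
  rw [act_mul, act_mul, act_refl, map_sub, map_smul, act_act_inv, hpole, hform]

/-- If a reflection in the group separates two boundary points spanning an edge of the cone, its
pole lies in the plane spanned by them. -/
lemma exists_eq_of_separates {φ : Vec 3 →ₗ[ℝ] ℝ} (hφ : ∀ x ∈ cone, 0 ≤ φ x) (h0 : φ ≠ 0)
    {p q : Vec 3} (hp : p ∈ closure cone) (hq : q ∈ closure cone) (ep : φ p = 0) (eq : φ q = 0)
    (hli : LinearIndependent ℝ ![p, q]) {g : GL (Fin 4) ℝ} (hg : g ∈ Gam) {β : Vec 3 → ℝ}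
    {b : Vec 3} (hgx : ∀ x, act g x = x - β x • b) (hβp : 0 < β p) (hβq : β q < 0) :
    ∃ s t : ℝ, b = s • p + t • q := by
  have h1 := nonneg_of_mem_closure hφ (act_mem_closure hg hp)
  have h2 := nonneg_of_mem_closure hφ (act_mem_closure hg hq)
  rw [hgx, map_sub, map_smul, smul_eq_mul] at h1 h2
  rw [ep] at h1
  rw [eq] at h2
  have hb : φ b = 0 := by
    apply le_antisymm <;> nlinarith
  obtain ⟨s, t, hst⟩ := exists_eq_of_face hφ h0 hp hq (act_mem_closure hg hp) ep eq
    (by rw [hgx, map_sub, map_smul, ep, hb, smul_zero, sub_zero]) hli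
  rw [hgx] at hst
  have e : β p • b = (1 - s) • p + (-t) • q := by
    have : β p • b = p - (s • p + t • q) := by rw [← hst, sub_sub_cancel]
    rw [this]
    module
  refine ⟨(β p)⁻¹ * (1 - s), (β p)⁻¹ * (-t), ?_⟩
  rw [← smul_smul, ← smul_smul, ← smul_add, ← e, inv_smul_smul₀ hβp.ne']

lemma apply_eq_zero_of_near_ver {φ : Vec 3 →ₗ[ℝ] ℝ} (hφ : ∀ x ∈ cone, 0 ≤ φ x) (h0 : φ ≠ 0)
    {p q : Vec 3} (hp : p ∈ closure cone) (hq : q ∈ closure cone) (ep : φ p = 0) (eq : φ q = 0)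
    (hli : LinearIndependent ℝ ![p, q]) {i j k : Fin 3} (hij : i ≠ j) (hik : i ≠ k) (hjk : j ≠ k)
    (h1 : 2 * p j.castSucc < p i.castSucc) (h2 : q i.castSucc < q j.castSucc) :
    p k.castSucc = 0 ∧ q k.castSucc = 0 := by
  have p1 := apply_nonneg hp j
  have q1 := apply_nonneg hq i
  obtain ⟨r, hr, hrx⟩ := exists_transposition hij
  obtain ⟨r', hr', hrx'⟩ := exists_homology hij
  obtain ⟨s, t, hst⟩ := exists_eq_of_separates hφ h0 hp hq ep eq hli hr
    (β := fun x => x i.castSucc - x j.castSucc) hrx (by linarith) (by linarith)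
  obtain ⟨t', s', hst'⟩ := exists_eq_of_separates hφ h0 hq hp eq ep
    (LinearIndependent.pair_symm_iff.1 hli) hr'
    (β := fun x => 2 * x j.castSucc - x i.castSucc) hrx' (by linarith) (by linarith)
  have e1 := congrFun hst k.castSucc
  have e2 := congrFun hst' k.castSucc
  simp only [Pi.sub_apply, Pi.add_apply, Pi.smul_apply, ver_apply_of_ne hik, ver_apply_of_ne hjk,
    smul_eq_mul, mul_zero, sub_zero] at e1 e2
  have hD : s * t' - t * s' ≠ 0 := by
    intro hD
    have f1 : t' • (ver i - ver j) - t • ((1 / 2 : ℝ) • ver j - ver i) = 0 := by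
      rw [hst, hst']
      have : t' • (s • p + t • q) - t • (t' • q + s' • p) = (s * t' - t * s') • p := by module
      rw [this, hD, zero_smul]
    have f2 : s' • (ver i - ver j) - s • ((1 / 2 : ℝ) • ver j - ver i) = 0 := by
      rw [hst, hst']
      have : s' • (s • p + t • q) - s • (t' • q + s' • p) = (-(s * t' - t * s')) • q := by module
      rw [this, hD, neg_zero, zero_smul]
    have a1 := congrFun f1 i.castSucc
    have a2 := congrFun f1 j.castSucc
    have a3 := congrFun f2 i.castSucc
    have a4 := congrFun f2 j.castSucc
    simp only [Pi.sub_apply, Pi.smul_apply, ver_apply_of_ne hij, ver_apply_of_ne hij.symm,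
      ver_apply_self, smul_eq_mul, Pi.zero_apply] at a1 a2 a3 a4
    have t0 : t = 0 := by linarith
    have s0 : s = 0 := by linarith
    have := congrFun hst i.castSucc
    simp [t0, s0, ver_apply_self, ver_apply_of_ne hij.symm] at this
  constructor
  · apply (mul_eq_zero.1 _).resolve_left hD
    linear_combination t * e2 - t' * e1
  · apply (mul_eq_zero.1 _).resolve_left hD
    linear_combination s' * e1 - s * e2

lemma exists_sub_smul_mem_cone {x y : Vec 3} (hx : x ∈ cone) : ∃ ε : ℝ, 0 < ε ∧ x - ε • y ∈ cone := by
  have hc : Filter.Tendsto (fun t : ℝ => x - t • y) (nhdsWithin 0 (Set.Ioi 0))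
      (nhds (x - (0 : ℝ) • y)) :=
    (Continuous.tendsto (by fun_prop) 0 : Filter.Tendsto (fun t : ℝ => x - t • y) _ _).mono_left
      nhdsWithin_le_nhds
  rw [zero_smul, sub_zero] at hc
  obtain ⟨ε, h1, h2⟩ := ((hc.eventually (isOpen_cone.mem_nhds hx)).and self_mem_nhdsWithin).exists
  exact ⟨ε, h2, h1⟩

/-- An edge of the cone is carried by the group into a side of the invariant triangle. -/
lemma exists_act_apply_eq_zero {φ : Vec 3 →ₗ[ℝ] ℝ} (hφ : ∀ x ∈ cone, 0 ≤ φ x) (h0 : φ ≠ 0)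
    {p q : Vec 3} (hp : p ∈ closure cone) (hq : q ∈ closure cone) (ep : φ p = 0) (eq : φ q = 0)
    (hli : LinearIndependent ℝ ![p, q]) (hpq : ∀ ε : ℝ, 0 < ε → p - ε • q ∉ closure cone)
    (hqp : ∀ ε : ℝ, 0 < ε → q - ε • p ∉ closure cone) :
    ∃ g ∈ Gam, ∃ k : Fin 3, act g p k.castSucc = 0 ∧ act g q k.castSucc = 0 := by
  have ho := basePt_mem_cone
  set o := basePt
  obtain ⟨g, l, hgl⟩ := exists_zoom (add_mem_closure hp hq) ho
  have hg := fun n => (hgl n).1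
  have hl := fun n => (hgl n).2.1
  have hz := fun n => (hgl n).2.2
  set d : ℕ → ℝ := fun n => 1 / ((n : ℝ) + 1) with hd
  have hdpos : ∀ n, 0 < d n := fun n => by positivity
  let L : ℕ → Vec 3 →ₗ[ℝ] Vec 3 := fun n => l n • act (g n)
  have hLc : ∀ n, ∀ v ∈ closure cone, L n v ∈ closure cone := fun n v hv =>
    smul_mem_closure (act_mem_closure (hg n) hv) (hl n).le
  have hLo : ∀ n v, L n v ∈ cone ↔ v ∈ cone := fun n v =>
    (smul_mem_cone_iff (hl n)).trans (act_mem_cone_iff (hg n))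
  have hLz : ∀ n, L n p + L n q + L n (d n • o) ∈ slice := fun n => by
    rw [← map_add, ← map_add]
    exact hz n
  have hdo : ∀ n, d n • o ∈ closure cone := fun n =>
    smul_mem_closure (subset_closure ho) (hdpos n).le
  obtain ⟨p', hp', hlp⟩ := exists_lim (isCompact_cap 1) (v := fun n => L n p)
    (fun n => mem_cap_of_add_mem_slice (hLc n _ hp) (add_mem_closure (hLc n _ hq) (hLc n _ (hdo n)))
      (by rw [← add_assoc]; exact hLz n))
  obtain ⟨q', hq', hlq⟩ := exists_lim (isCompact_cap 1) (v := fun n => L n q)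
    (fun n => mem_cap_of_add_mem_slice (hLc n _ hq) (add_mem_closure (hLc n _ hp) (hLc n _ (hdo n)))
      (by rw [← add_assoc, add_comm (L n q)]; exact hLz n))
  obtain ⟨o', ho', hlo⟩ := exists_lim (isCompact_cap 1) (v := fun n => L n (d n • o))
    (fun n => mem_cap_of_add_mem_slice (hLc n _ (hdo n)) (add_mem_closure (hLc n _ hp) (hLc n _ hq))
      (by rw [add_comm]; exact hLz n))
  have hzs : p' + q' + o' ∈ slice := isCompact_slice.isClosed.mem_of_tendsto
    ((hlp.add hlq).add hlo) (Filter.Eventually.of_forall hLz)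
  have hzc := slice_subset_cone hzs
  have n1 : p' + q' ∉ cone := by
    intro hc
    obtain ⟨n, hn⟩ : ∃ n, L n p + L n q ∈ cone :=
      ((hlp.add hlq).eventually (isOpen_cone.mem_nhds hc)).exists
    rw [← map_add, hLo] at hn
    have := pos_of_mem_cone hφ h0 hn
    rw [map_add, ep, eq, add_zero] at this
    exact lt_irrefl _ this
  have hside : ∀ {a b a' b' : Vec 3}, (∀ ε : ℝ, 0 < ε → a - ε • b ∉ closure cone) →
      Filter.Tendsto (fun n => L n a) (Filter.hyperfilter ℕ : Filter ℕ) (nhds a') →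
      Filter.Tendsto (fun n => L n b) (Filter.hyperfilter ℕ : Filter ℕ) (nhds b') →
      a' + o' ∉ cone := by
    intro a b a' b' hab hla hlb hc
    obtain ⟨ε, hε, hm⟩ := exists_sub_smul_mem_cone (y := b') hc
    apply hab ε hε
    have h1 : ∀ᶠ n in (Filter.hyperfilter ℕ : Filter ℕ), L n a + L n (d n • o) - ε • L n b ∈ cone :=
      ((hla.add hlo).sub (hlb.const_smul ε)).eventually (isOpen_cone.mem_nhds hm)
    have h2 : Filter.Tendsto (fun n => a + d n • o - ε • b) (Filter.hyperfilter ℕ : Filter ℕ)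
        (nhds (a - ε • b)) := by
      have := ((tendsto_const_nhds (x := a)).add (tendsto_one_div.smul_const o)).sub_const (ε • b)
      rwa [zero_smul, add_zero] at this
    refine isClosed_closure.mem_of_tendsto h2 ?_
    filter_upwards [h1] with n hn
    rw [← map_add, ← map_smul, ← map_sub, hLo] at hn
    exact subset_closure hn
  have n2 : p' + o' ∉ cone := hside hpq hlp hlq
  have n3 : q' + o' ∉ cone := hside hqp hlq hlp
  obtain ⟨f0, f0c, f01, f02, f03⟩ := exists_dual_of_add_notMem hq'.1 ho'.1 n3 (c := p') (by
    rw [add_right_comm, add_comm q']; exact hzc)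
  obtain ⟨f1, f1c, f11, f12, f13⟩ := exists_dual_of_add_notMem hp'.1 ho'.1 n2 (c := q') (by
    rw [add_right_comm]; exact hzc)
  obtain ⟨f2, f2c, f21, f22, f23⟩ := exists_dual_of_add_notMem hp'.1 hq'.1 n1 (c := o') hzc
  have hver := exists_eq_smul_ver (e := ![p', q', o']) (φ := ![f0, f1, f2])
    (by intro l; fin_cases l; exacts [hp'.1, hq'.1, ho'.1])
    (by intro l; fin_cases l; exacts [f0c, f1c, f2c])
    (by intro l; fin_cases l; exacts [f01, f11, f21])
    (by
      intro l m hlm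
      fin_cases l <;> fin_cases m
      exacts [absurd rfl hlm, f02, f03, f12, absurd rfl hlm, f13, f22, f23, absurd rfl hlm])
    (by rw [Fin.sum_univ_three]; exact hzs.1)
  obtain ⟨i, c, hc, hi⟩ := hver 0
  obtain ⟨j, c', hc', hj⟩ := hver 1
  change p' = _ at hi
  change q' = _ at hj
  have hij : i ≠ j := by
    rintro rfl
    rw [hj, map_smul, smul_eq_mul] at f02
    rw [hi, map_smul, (mul_eq_zero.1 f02).resolve_left hc'.ne', smul_zero] at f01
    exact zero_ne_one f01
  obtain ⟨k, hik, hjk⟩ : ∃ k, i ≠ k ∧ j ≠ k := by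
    have : ∀ i j : Fin 3, ∃ k, i ≠ k ∧ j ≠ k := by decide
    exact this i j
  have hco : ∀ m : Fin 3, Continuous fun x : Vec 3 => x m.castSucc := fun m => continuous_apply _
  have t1 : ∀ᶠ n in (Filter.hyperfilter ℕ : Filter ℕ),
      2 * L n p j.castSucc < L n p i.castSucc := by
    refine (((hco j).tendsto p').comp hlp |>.const_mul 2).eventually_lt
      (((hco i).tendsto p').comp hlp) ?_
    simp only [hi, Pi.smul_apply, ver_apply_self, ver_apply_of_ne hij, smul_eq_mul]
    linarith
  have t2 : ∀ᶠ n in (Filter.hyperfilter ℕ : Filter ℕ),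
      L n q i.castSucc < L n q j.castSucc := by
    refine (((hco i).tendsto q').comp hlq).eventually_lt (((hco j).tendsto q').comp hlq) ?_
    simp only [hj, Pi.smul_apply, ver_apply_self, ver_apply_of_ne hij.symm, smul_eq_mul]
    linarith
  obtain ⟨n, u1, u2⟩ := (t1.and t2).exists
  have hli' : LinearIndependent ℝ ![act (g n) p, act (g n) q] := by
    have h1 := hli.map' (act (g n)) (LinearMap.ker_eq_bot_of_injective
      (Function.LeftInverse.injective (act_inv_act (g n))))
    have e : ![act (g n) p, act (g n) q] = act (g n) ∘ ![p, q] := by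
      funext m
      fin_cases m <;> rfl
    rwa [e]
  have hl0 := hl n
  have hψ0 : φ.comp (act (g n)⁻¹) ≠ 0 := by
    intro hc
    apply h0
    refine LinearMap.ext fun x => ?_
    have := LinearMap.congr_fun hc (act (g n) x)
    rwa [LinearMap.comp_apply, act_inv_act] at this
  refine ⟨g n, hg n, k, ?_⟩
  refine apply_eq_zero_of_near_ver (φ := φ.comp (act (g n)⁻¹))
    (fun x hx => hφ _ (act_mem_cone (inv_mem (hg n)) hx)) hψ0
    (act_mem_closure (hg n) hp) (act_mem_closure (hg n) hq)
    (by rw [LinearMap.comp_apply, act_inv_act, ep]) (by rw [LinearMap.comp_apply, act_inv_act, eq])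
    hli' hij hik hjk ?_ ?_
  · change 2 * (l n * act (g n) p j.castSucc) < l n * act (g n) p i.castSucc at u1
    rw [mul_left_comm] at u1
    exact lt_of_mul_lt_mul_left u1 hl0.le
  · exact lt_of_mul_lt_mul_left u2 hl0.le

lemma exists_max_sub_smul {v w : Vec 3} (hv : v ∈ closure cone) (hw : w ∈ closure cone)
    (h0 : w ≠ 0) : ∃ t : ℝ, 0 ≤ t ∧ v - t • w ∈ closure cone ∧
      ∀ s : ℝ, t < s → v - s • w ∉ closure cone := by
  have hpos : 0 < hgt ⬝ᵥ w := by
    refine (hgt_nonneg hw).lt_of_ne fun hc => h0 ?_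
    ext k
    have := abs_apply_le hw k
    rw [← hc, mul_zero] at this
    exact abs_nonpos_iff.1 this
  have hbd : ∀ s : ℝ, v - s • w ∈ closure cone → s ≤ hgt ⬝ᵥ v / hgt ⬝ᵥ w := by
    intro s hs
    have := hgt_nonneg hs
    rw [dotProduct_sub, dotProduct_smul, smul_eq_mul] at this
    rw [le_div_iff₀ hpos]
    linarith
  have hcl : IsClosed {s : ℝ | v - s • w ∈ closure cone} :=
    isClosed_closure.preimage (f := fun s : ℝ => v - s • w) (by fun_prop)
  have hK : IsCompact (Set.Icc 0 (hgt ⬝ᵥ v / hgt ⬝ᵥ w) ∩ {s : ℝ | v - s • w ∈ closure cone}) :=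
    isCompact_Icc.inter_right hcl
  have hz : v - (0 : ℝ) • w ∈ closure cone := by rwa [zero_smul, sub_zero]
  obtain ⟨t, ⟨ht, htc⟩, hmax⟩ := hK.exists_isGreatest ⟨0, ⟨le_rfl, hbd 0 hz⟩, hz⟩
  refine ⟨t, ht.1, htc, fun s hts hs => hts.not_ge (hmax ⟨⟨ht.1.trans hts.le, hbd s hs⟩, hs⟩)⟩

lemma exists_act_apply_eq_zero_of_add_notMem {v w : Vec 3} (hv : v ∈ closure cone)
    (hw : w ∈ closure cone) (hli : LinearIndependent ℝ ![v, w]) (hvw : v + w ∉ cone) :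
    ∃ g ∈ Gam, ∃ k : Fin 3, act g v k.castSucc = 0 ∧ act g w k.castSucc = 0 := by
  obtain ⟨φ, hφ, h0, hle⟩ := exists_supporting hvw
  rw [map_add] at hle
  have hφv := nonneg_of_mem_closure hφ hv
  have hφw := nonneg_of_mem_closure hφ hw
  have ev : φ v = 0 := by linarith
  have ew : φ w = 0 := by linarith
  rw [LinearIndependent.pair_iff] at hli
  obtain ⟨t, ht, hp, htmax⟩ := exists_max_sub_smul hv hw (by
    rintro rfl
    exact one_ne_zero (hli 0 1 (by simp)).2)
  have hp0 : v - t • w ≠ 0 := by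
    intro hc
    exact one_ne_zero (hli 1 (-t) (by rw [← hc]; module)).1
  obtain ⟨s, hs, hq, hsmax⟩ := exists_max_sub_smul hw hp hp0
  have hli' : LinearIndependent ℝ ![v - t • w, w - s • (v - t • w)] := by
    rw [LinearIndependent.pair_iff]
    intro a b hab
    obtain ⟨h1, h2⟩ := hli (a - b * s) (b * (1 + s * t) - a * t) (by rw [← hab]; module)
    have hb : b = 0 := by linear_combination h2 + t * h1
    refine ⟨?_, hb⟩
    rw [hb] at h1
    linarith
  obtain ⟨g, hg, k, k1, k2⟩ := exists_act_apply_eq_zero hφ h0 hp hq (by simp [ev, ew])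
    (by simp [ev, ew]) hli'
    (by
      intro ε hε hc
      have hd : 0 < 1 + ε * s := by positivity
      refine htmax (t + ε / (1 + ε * s)) (by linarith [div_pos hε hd]) ?_
      have := smul_mem_closure hc (inv_pos.2 hd).le
      convert this using 1
      have e : v - t • w - ε • (w - s • (v - t • w)) =
          (1 + ε * s) • (v - (t + ε / (1 + ε * s)) • w) := by
        rw [smul_sub (1 + ε * s) v, smul_smul (1 + ε * s), mul_add (1 + ε * s), mul_div_cancel₀ _ hd.ne']
        module
      rw [e, inv_smul_smul₀ hd.ne'])
    (by
      intro ε hε hc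
      refine hsmax (s + ε) (by linarith) ?_
      convert hc using 1
      module)
  have k3 : act g w k.castSucc = 0 := by
    have : w = (w - s • (v - t • w)) + s • (v - t • w) := by module
    rw [this, map_add, map_smul, Pi.add_apply, Pi.smul_apply, k1, k2, smul_zero, add_zero]
  refine ⟨g, hg, k, ?_, k3⟩
  have : v = (v - t • w) + t • w := by module
  rw [this, map_add, map_smul, Pi.add_apply, Pi.smul_apply, k1, k3, smul_zero, add_zero]

/-- The endpoints of a boundary segment lift to the same component of the boundary cone. -/
lemma mem_closure_or_neg_mem_closure {v w : Vec 3} (hli : LinearIndependent ℝ ![v, w])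
    (h : ∀ t ∈ Set.Icc (0 : ℝ) 1, ∀ h : t • v + (1 - t) • w ≠ 0,
      Projectivization.mk ℝ (t • v + (1 - t) • w) h ∈ frontier Omg) :
    ((v ∈ closure cone ∧ w ∈ closure cone) ∨ (-v ∈ closure cone ∧ -w ∈ closure cone)) ∧
      v + w ∉ cone ∧ -(v + w) ∉ cone := by
  rw [LinearIndependent.pair_iff] at hli
  have hne : ∀ t : ℝ, t • v + (1 - t) • w ≠ 0 := by
    intro t hc
    obtain ⟨h1, h2⟩ := hli _ _ hc
    rw [h1, sub_zero] at h2
    exact one_ne_zero h2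
  have hmem := fun t ht => (mk_mem_frontier_iff (hne t)).1 (h t ht (hne t))
  have hz : ∀ t ∈ Set.Icc (0 : ℝ) 1, hgt ⬝ᵥ (t • v + (1 - t) • w) ≠ 0 := by
    intro t ht hc
    apply hne t
    ext k
    rcases (hmem t ht).1 with h1 | h1
    · have := abs_apply_le h1 k
      rw [hc, mul_zero] at this
      exact abs_nonpos_iff.1 this
    · have := abs_apply_le h1 k
      rw [dotProduct_neg, hc, neg_zero, mul_zero, Pi.neg_apply, abs_neg] at this
      exact abs_nonpos_iff.1 this
  have m1 := (hmem 1 ⟨zero_le_one, le_rfl⟩).1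
  have m0 := (hmem 0 ⟨le_rfl, zero_le_one⟩).1
  have mh := (hmem (1 / 2) ⟨by norm_num, by norm_num⟩).2
  simp only [one_smul, sub_self, zero_smul, add_zero] at m1
  simp only [zero_smul, sub_zero, one_smul, zero_add] at m0
  have eh : ((1 / 2 : ℝ) • v + (1 - 1 / 2 : ℝ) • w) = (1 / 2 : ℝ) • (v + w) := by module
  rw [eh, ← smul_neg, smul_mem_cone_iff (by norm_num), smul_mem_cone_iff (by norm_num)] at mh
  refine ⟨?_, mh⟩
  have hcont : ContinuousOn (fun t : ℝ => hgt ⬝ᵥ (t • v + (1 - t) • w)) (Set.Icc 0 1) :=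
    Continuous.continuousOn (continuous_const.dotProduct (by fun_prop))
  have f0 : hgt ⬝ᵥ ((0 : ℝ) • v + (1 - 0 : ℝ) • w) = hgt ⬝ᵥ w := by simp
  have f1 : hgt ⬝ᵥ ((1 : ℝ) • v + (1 - 1 : ℝ) • w) = hgt ⬝ᵥ v := by simp
  rcases m1 with m1 | m1 <;> rcases m0 with m0 | m0
  · exact Or.inl ⟨m1, m0⟩
  · have g1 := hgt_nonneg m1
    have g0 := hgt_nonneg m0
    rw [dotProduct_neg] at g0
    obtain ⟨t, ht, e⟩ := intermediate_value_Icc zero_le_one hcont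
      (show (0 : ℝ) ∈ Set.Icc _ _ from ⟨by rw [f0]; linarith, by rw [f1]; exact g1⟩)
    exact absurd e (hz t ht)
  · have g1 := hgt_nonneg m1
    have g0 := hgt_nonneg m0
    rw [dotProduct_neg] at g1
    obtain ⟨t, ht, e⟩ := intermediate_value_Icc' zero_le_one hcont
      (show (0 : ℝ) ∈ Set.Icc _ _ from ⟨by rw [f1]; linarith, by rw [f0]; exact g0⟩)
    exact absurd e (hz t ht)
  · exact Or.inr ⟨m1, m0⟩

lemma sum_smul_ver_apply (t : Fin 3 → ℝ) (j : Fin 3) :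
    (∑ i, t i • ver i) j.castSucc = t j := by
  fin_cases j <;> simp [ver_eq, Fin.sum_univ_three]

lemma sum_smul_ver_apply_three (t : Fin 3 → ℝ) : (∑ i, t i • ver i) 3 = 0 := by
  simp [ver_eq, Fin.sum_univ_three]

/-- The images of the vertices of the invariant triangle. -/
def tri (g : GL (Fin 4) ℝ) (i : Fin 3) : Vec 3 := act g⁻¹ (ver i)

lemma sum_smul_tri (g : GL (Fin 4) ℝ) (t : Fin 3 → ℝ) :
    ∑ i, t i • tri g i = act g⁻¹ (∑ i, t i • ver i) := by
  simp [tri, map_sum]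

lemma act_sum_smul_tri (g : GL (Fin 4) ℝ) (t : Fin 3 → ℝ) :
    act g (∑ i, t i • tri g i) = ∑ i, t i • ver i := by
  rw [sum_smul_tri, act_act_inv]

lemma sum_smul_tri_ne_zero (g : GL (Fin 4) ℝ) {t : Fin 3 → ℝ} (ht : t ≠ 0) :
    ∑ i, t i • tri g i ≠ 0 := by
  intro hc
  apply ht
  ext j
  rw [← sum_smul_ver_apply t j, ← act_sum_smul_tri g, hc, map_zero]
  rfl

lemma simplexInterior_tri_subset {g : GL (Fin 4) ℝ} (hg : g ∈ Gam) :
    simplexInterior (tri g) ⊆ Omg := by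
  rintro P ⟨t, ht, hne, rfl⟩
  rw [mk_mem_Omg_iff, ← act_mem_cone_iff hg, act_sum_smul_tri]
  exact Or.inl (mem_cone_of_pos (fun i => by rw [sum_smul_ver_apply]; exact ht i)
    (sum_smul_ver_apply_three t))

lemma notMem_cone_of_apply_eq_zero {g : GL (Fin 4) ℝ} (hg : g ∈ Gam) {x : Vec 3} {k : Fin 3}
    (hk : act g x k.castSucc = 0) : x ∉ cone ∧ -x ∉ cone := by
  refine ⟨fun hc => (apply_pos (act_mem_cone hg hc) k).ne' hk, fun hc =>
    (apply_pos (act_mem_cone hg hc) k).ne' ?_⟩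
  rw [map_neg, Pi.neg_apply, hk, neg_zero]

lemma properlyEmbeddedSimplex_tri {g : GL (Fin 4) ℝ} (hg : g ∈ Gam) :
    ProperlyEmbeddedSimplex Omg (tri g) := by
  refine ⟨?_, simplexInterior_tri_subset hg, ?_⟩
  · rw [Fintype.linearIndependent_iff]
    intro t ht i
    by_contra hi
    exact sum_smul_tri_ne_zero g (t := t) (fun hc => hi (by rw [hc]; rfl)) ht
  · rintro P ⟨⟨t, ht, -, hne, rfl⟩, hin⟩
    obtain ⟨k, hk⟩ : ∃ k, t k = 0 := by
      by_contra hcon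
      push Not at hcon
      exact hin ⟨t, fun i => (ht i).lt_of_ne (hcon i).symm, hne, rfl⟩
    rw [mk_mem_frontier_iff]
    refine ⟨Or.inl ?_, notMem_cone_of_apply_eq_zero hg (k := k) ?_⟩
    · rw [Fin.sum_univ_three]
      have h := fun i => smul_mem_closure
        (act_mem_closure (inv_mem hg) (ver_mem_closure i)) (ht i)
      exact add_mem_closure (add_mem_closure (h 0) (h 1)) (h 2)
    · rw [act_sum_smul_tri, sum_smul_ver_apply, hk]

lemma mk_mem_boundary_tri {g : GL (Fin 4) ℝ} (hg : g ∈ Gam) {x : Vec 3} (hx : x ≠ 0)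
    (hxc : x ∈ closure cone ∨ -x ∈ closure cone) {k : Fin 3} (hk : act g x k.castSucc = 0) :
    Projectivization.mk ℝ x hx ∈ simplexSet (tri g) \ simplexInterior (tri g) := by
  refine ⟨?_, fun hc => ?_⟩
  · obtain ⟨y, hy0, hy, hyk, e⟩ : ∃ (y : Vec 3) (hy : y ≠ 0), y ∈ closure cone ∧
        act g y k.castSucc = 0 ∧ Projectivization.mk ℝ x hx = Projectivization.mk ℝ y hy := by
      rcases hxc with h | h
      · exact ⟨x, hx, h, hk, rfl⟩
      · refine ⟨-x, neg_ne_zero.2 hx, h, by rw [map_neg, Pi.neg_apply, hk, neg_zero], ?_⟩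
        rw [Projectivization.mk_eq_mk_iff']
        exact ⟨-1, by simp⟩
    have hc := act_mem_closure hg hy
    have h3 := apply_three_eq_zero hc hyk
    have hs : ∑ i : Fin 3, act g y i.castSucc • tri g i = y := by
      rw [sum_smul_tri, ← act_inv_act g y, act_act_inv]
      congr 1
      ext j
      refine Fin.lastCases ?_ (fun j => ?_) j
      · rw [show Fin.last 3 = 3 from rfl, sum_smul_ver_apply_three, h3]
      · exact sum_smul_ver_apply (fun i => act g y i.castSucc) j
    refine ⟨fun i => act g y i.castSucc, fun i => apply_nonneg hc i, ?_, by rwa [hs], ?_⟩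
    · intro h
      apply hy0
      rw [← hs]
      exact Finset.sum_eq_zero fun i _ => by rw [show act g y i.castSucc = 0 from congrFun h i,
        zero_smul]
    · rw [e]
      congr 1
      exact hs.symm
  · obtain ⟨h1, h2⟩ := notMem_cone_of_apply_eq_zero hg hk
    exact ((mk_mem_Omg_iff hx).1 (simplexInterior_tri_subset hg hc)).elim h1 h2

lemma exists_properlyEmbeddedSimplex {v w : Vec 3} (hli : LinearIndependent ℝ ![v, w])
    (h : ∀ t ∈ Set.Icc (0 : ℝ) 1, ∀ h : t • v + (1 - t) • w ≠ 0,
      Projectivization.mk ℝ (t • v + (1 - t) • w) h ∈ frontier Omg) :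
    ∃ u : Fin 3 → Vec 3, ProperlyEmbeddedSimplex Omg u ∧
      {P : RP 3 | ∃ t ∈ Set.Icc (0 : ℝ) 1, ∃ h : t • v + (1 - t) • w ≠ 0,
        P = Projectivization.mk ℝ (t • v + (1 - t) • w) h} ⊆
      simplexSet u \ simplexInterior u := by
  obtain ⟨hc, h1, h2⟩ := mem_closure_or_neg_mem_closure hli h
  obtain ⟨g, hg, k, hv, hw⟩ :
      ∃ g ∈ Gam, ∃ k : Fin 3, act g v k.castSucc = 0 ∧ act g w k.castSucc = 0 := by
    rcases hc with ⟨hv, hw⟩ | ⟨hv, hw⟩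
    · exact exists_act_apply_eq_zero_of_add_notMem hv hw hli h1
    · obtain ⟨g, hg, k, k1, k2⟩ := exists_act_apply_eq_zero_of_add_notMem hv hw
        (by
          rw [LinearIndependent.pair_iff] at hli ⊢
          intro s t hst
          have := hli (-s) (-t) (by rw [← hst]; module)
          exact ⟨neg_eq_zero.1 this.1, neg_eq_zero.1 this.2⟩)
        (by rwa [← neg_add])
      rw [map_neg, Pi.neg_apply, neg_eq_zero] at k1 k2
      exact ⟨g, hg, k, k1, k2⟩
  refine ⟨tri g, properlyEmbeddedSimplex_tri hg, ?_⟩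
  rintro P ⟨t, ht, hne, rfl⟩
  refine mk_mem_boundary_tri hg hne (k := k) ?_ ?_
  · exact ((mk_mem_frontier_iff hne).1 (h t ht hne)).1
  · rw [map_add, map_smul, map_smul, Pi.add_apply, Pi.smul_apply, Pi.smul_apply, hv, hw, smul_zero,
      smul_zero, add_zero]

end

end BenoistPrism

/-- Benoist: there is an indecomposable divisible properly convex domain `Ω ⊆ ℝP³` which
is not strictly convex, and every nondegenerate line segment in `∂Ω` lies in the boundary
of a properly embedded triangle of `Ω`. -/
theorem exists_indecomposable_divisible_not_strictly_convex_dim3 :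
    ∃ (Ω : Set (RP 3)) (Γ : Subgroup (GL (Fin 4) ℝ)),
      IsProperlyConvexDomain Ω ∧ Divides Γ Ω ∧ StronglyIrreducible Γ ∧
      ¬ IsStrictlyConvexDomain Ω ∧
      ∀ v w : Vec 3, LinearIndependent ℝ ![v, w] →
        (∀ t ∈ Set.Icc (0 : ℝ) 1, ∀ h : t • v + (1 - t) • w ≠ 0,
          Projectivization.mk ℝ (t • v + (1 - t) • w) h ∈ frontier Ω) →
        ∃ u : Fin 3 → Vec 3, ProperlyEmbeddedSimplex Ω u ∧
          {P : RP 3 | ∃ t ∈ Set.Icc (0 : ℝ) 1, ∃ h : t • v + (1 - t) • w ≠ 0,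
              P = Projectivization.mk ℝ (t • v + (1 - t) • w) h} ⊆
            simplexSet u \ simplexInterior u := by
  exact ⟨BenoistPrism.Omg, BenoistPrism.Gam, ⟨BenoistPrism.cone, BenoistPrism.isProperCone_cone, rfl⟩,
    BenoistPrism.divides_Gam, BenoistPrism.stronglyIrreducible_Gam,
    BenoistPrism.not_isStrictlyConvexDomain,
    fun _ _ hli h => BenoistPrism.exists_properlyEmbeddedSimplex hli h⟩
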